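/- arXiv:2012.15011 — 3 statements merged into one kernel-verified Lean document; each statement's English description precedes it below -/
import Mathlib

section
/- Fix ℓ ≥ 1 and work with functions ℤ → R, where R = ℤ[x, t_1,…,t_{ℓ−1}] (or any commutative ring containing these elements). For a function f : ℤ → R supported on ℤ_{≥0}, define Δ_t f(ν) = f(ν+1) − t·f(ν) and Δ_t^{−1} f(ν) = Σ_{μ=0}^{ν−1} t^{ν−1−μ} f(μ) (so Δ_t^{−1}f(ν) = 0 for ν ≤ 0). For 1 ≤ i,j ≤ ℓ define the multiple operator Δ_t^{j−i} := Δ_{t_i} Δ_{t_{i+1}} ⋯ Δ_{t_{j−1}} if j ≥ i (the identity when j = i), and Δ_t^{j−i} := Δ_{t_j}^{−1} Δ_{t_{j+1}}^{−1} ⋯ Δ_{t_{i−1}}^{−1} if j < i. Let v : ℤ → R be v(ν) = x^ν for ν ≥ 0 and v(ν) = 0 for ν < 0. Then for all partitions λ = (λ_1 ≥ … ≥ λ_ℓ ≥ 0) and μ = (μ_1 ≥ … ≥ μ_ℓ ≥ 0): det[ Δ_t^{j−i} v(λ_i − μ_j) ]_{i,j=1}^{ℓ} = ∏_{j=1}^{ℓ}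 t_j^{max(μ_j, λ_{j+1}) − μ_j} · v(λ_j − max(μ_j, λ_{j+1})), where λ_{ℓ+1} := 0 (the exponent of t_ℓ is always 0, so only t_1,…,t_{ℓ−1} appear). -/
noncomputable section

variable {R : Type*} [CommRing R]

/-- The `t`-weighted forward difference operator `Δ_t f (ν) = f(ν+1) - t f(ν)`. -/
def Dop (t : R) (f : ℤ → R) : ℤ → R := fun ν => f (ν + 1) - t * f ν

/-- The inverse operator `Δ_t⁻¹ f (ν) = Σ_{μ=0}^{ν-1} t^{ν-1-μ} f(μ)`
(so `Δ_t⁻¹ f (ν) = 0` for `ν ≤ 0`). -/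
def Dinv (t : R) (f : ℤ → R) : ℤ → R := fun ν =>
  ∑ μ ∈ Finset.range ν.toNat, t ^ (ν.toNat - 1 - μ) * f μ

/-- `k`-fold composition `Δ_{t_a} Δ_{t_{a+1}} ⋯ Δ_{t_{a+k-1}}`. -/
def DopIter (t : ℕ → R) (a : ℕ) : ℕ → (ℤ → R) → ℤ → R
  | 0 => fun f => f
  | k + 1 => fun f => Dop (t a) (DopIter t (a + 1) k f)

/-- `k`-fold composition `Δ_{t_a}⁻¹ Δ_{t_{a+1}}⁻¹ ⋯ Δ_{t_{a+k-1}}⁻¹`. -/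
def DinvIter (t : ℕ → R) (a : ℕ) : ℕ → (ℤ → R) → ℤ → R
  | 0 => fun f => f
  | k + 1 => fun f => Dinv (t a) (DinvIter t (a + 1) k f)

/-- The multiple weighted difference operator `Δ_t^{j-i}`: for `i ≤ j` it is
`Δ_{t_i} Δ_{t_{i+1}} ⋯ Δ_{t_{j-1}}`, and for `j < i` it is
`Δ_{t_j}⁻¹ Δ_{t_{j+1}}⁻¹ ⋯ Δ_{t_{i-1}}⁻¹`. -/
def Dmulti (t : ℕ → R) (i j : ℕ) (f : ℤ → R) : ℤ → R :=
  if i ≤ j then DopIter t i (j - i) f else DinvIter t j (i - j) f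

/-- The function `ν ↦ x ^ ν` on the nonnegative integers, extended by zero. -/
def powFun (x : R) : ℤ → R := fun ν => if 0 ≤ ν then x ^ ν.toNat else 0

theorem powFun_natCast (x : R) (n : ℕ) : powFun x n = x ^ n := by
  simp [powFun]

theorem DopIter_powFun (t : ℕ → R) (x : R) (k : ℕ) (a n : ℕ) :
    DopIter t a k (powFun x) n = x ^ n * ∏ r ∈ Finset.range k, (x - t (a + r)) := by
  induction k generalizing a n with
  | zero => simp [DopIter, powFun_natCast]
  | succ k ih =>
    have hn := ih (a + 1) n
    have hn' := ih (a + 1) (n + 1)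
    push_cast at hn'
    have hprod : ∏ r ∈ Finset.range k, (x - t (a + (r + 1))) =
        ∏ r ∈ Finset.range k, (x - t (a + 1 + r)) :=
      Finset.prod_congr rfl fun r _ => by rw [add_assoc, add_comm 1 r]
    simp only [DopIter, Dop]
    rw [hn, hn', Finset.prod_range_succ', hprod]
    simp only [add_zero]
    ring

theorem DinvIter_of_nonpos (t : ℕ → R) (a k : ℕ) (f : ℤ → R) {ν : ℤ} (hν : ν ≤ 0) :
    DinvIter t a (k + 1) f ν = 0 := by
  simp [DinvIter, Dinv, Int.toNat_of_nonpos hν]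

theorem sub_mul_Dinv_powFun (t x : R) (n : ℕ) :
    (x - t) * Dinv t (powFun x) n = x ^ n - t ^ n := by
  rw [← (Commute.all x t).mul_geom_sum₂ n]
  congr 1
  simp only [Dinv, Int.toNat_natCast, powFun_natCast]
  exact Finset.sum_congr rfl fun i _ => mul_comm _ _

theorem Dmulti_self (t : ℕ → R) (a : ℕ) (f : ℤ → R) : Dmulti t a a f = f := by
  simp [Dmulti, DopIter]

theorem Dmulti_add_right (t : ℕ → R) (a k : ℕ) (f : ℤ → R) :
    Dmulti t a (k + a) f = DopIter t a k f := by
  simp [Dmulti]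

theorem Dmulti_of_lt (t : ℕ → R) (a k : ℕ) (f : ℤ → R) :
    Dmulti t (k + 1 + a) a f = DinvIter t a (k + 1) f := by
  simp [Dmulti]

theorem det_Dmulti_powFun (n a : ℕ) (t : ℕ → R) (x : R) (lam mu : ℕ → ℕ)
    (hlam : ∀ a b : ℕ, a ≤ b → b < n → lam b ≤ lam a)
    (hmu : ∀ a b : ℕ, a ≤ b → b < n → mu b ≤ mu a) :
    Matrix.det (Matrix.of fun i j : Fin n =>
        Dmulti t (i.1 + a) (j.1 + a) (powFun x) ((lam i.1 : ℤ) - (mu j.1 : ℤ))) =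
      ∏ j : Fin n,
        t (j.1 + a) ^ (max (mu j.1) (if j.1 + 1 < n then lam (j.1 + 1) else 0) - mu j.1) *
          powFun x ((lam j.1 : ℤ) -
            ((max (mu j.1) (if j.1 + 1 < n then lam (j.1 + 1) else 0) : ℕ) : ℤ)) := by
  induction n generalizing a lam mu with
  | zero => simp
  | succ n ih =>
    have key := ih (a + 1) (fun k => lam (k + 1)) (fun k => mu (k + 1))
      (fun b c hbc hc => hlam _ _ (by omega) (by omega))
      (fun b c hbc hc => hmu _ _ (by omega) (by omega))
    set M : Matrix (Fin (n + 1)) (Fin (n + 1)) R := Matrix.of fun i j =>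
      Dmulti t (i.1 + a) (j.1 + a) (powFun x) ((lam i.1 : ℤ) - (mu j.1 : ℤ)) with hM
    have hminor : (M.submatrix Fin.succ Fin.succ).det =
        ∏ j : Fin n, t (j.succ.1 + a) ^
          (max (mu j.succ.1) (if j.succ.1 + 1 < n + 1 then lam (j.succ.1 + 1) else 0)
            - mu j.succ.1) *
          powFun x ((lam j.succ.1 : ℤ) - ((max (mu j.succ.1)
            (if j.succ.1 + 1 < n + 1 then lam (j.succ.1 + 1) else 0) : ℕ) : ℤ)) := by
      simp only [Fin.val_succ, add_lt_add_iff_right] at key ⊢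
      simp only [← add_assoc, add_right_comm _ a 1] at key
      rw [← key]
      congr 1
    rw [Fin.prod_univ_succ, ← hminor]
    by_cases hcase : ∀ i : Fin n, lam (i.1 + 1) ≤ mu 0
    · have hcol : ∀ i : Fin n, M i.succ 0 = 0 := fun i => by
        have := hcase i
        simp only [hM, Matrix.of_apply, Fin.val_succ, Fin.val_zero, zero_add]
        rw [Dmulti_of_lt]
        exact DinvIter_of_nonpos _ _ _ _ (by omega)
      have hmax : max (mu (0 : Fin (n + 1)).1)
          (if (0 : Fin (n + 1)).1 + 1 < n + 1 then lam ((0 : Fin (n + 1)).1 + 1) else 0) =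
            mu 0 := by
        rw [Fin.val_zero]
        split_ifs with h
        · exact max_eq_left (hcase ⟨0, by omega⟩)
        · simp
      rw [hmax, Matrix.det_succ_column_zero, Fin.sum_univ_succ]
      simp only [hcol, Fin.val_zero]
      simp [hM, Dmulti_self, Fin.succAbove_zero]
    · push Not at hcase
      obtain ⟨i, hi⟩ := hcase
      have hn : 0 < n := i.pos
      obtain ⟨m, rfl⟩ : ∃ m, n = m + 1 := ⟨n - 1, by omega⟩
      have h10 : lam 1 ≤ lam 0 := hlam 0 1 (by omega) (by omega)
      have hi1 : mu 0 < lam 1 := hi.trans_le (hlam 1 (i.1 + 1) (by omega) (by omega))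
      obtain ⟨p, hp⟩ := Nat.exists_eq_add_of_le h10
      obtain ⟨q, hq⟩ := Nat.exists_eq_add_of_le hi1.le
      have hdet := Matrix.det_updateRow_add_smul_self M
        (show (0 : Fin (m + 1 + 1)) ≠ 1 by simp) (-(x ^ p * (x - t a)))
      have hrow0 : (M 0 + (-(x ^ p * (x - t a))) • M 1) 0 = x ^ p * t a ^ q := by
        have e0 : M 0 0 = x ^ (q + p) := by
          have : (lam 0 : ℤ) - mu 0 = (q + p : ℕ) := by omega
          simp only [hM, Matrix.of_apply, Fin.val_zero, Dmulti_self]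
          rw [this, powFun_natCast]
        have e1 : M 1 0 = Dinv (t a) (powFun x) q := by
          have : (lam 1 : ℤ) - mu 0 = (q : ℕ) := by omega
          simp only [hM, Matrix.of_apply, Fin.val_zero, Fin.val_one, zero_add]
          rw [this]
          exact congrFun (Dmulti_of_lt t a 0 _) _
        have hD := sub_mul_Dinv_powFun (t a) x q
        simp only [Pi.add_apply, Pi.smul_apply, smul_eq_mul, e0, e1]
        linear_combination (-x ^ p) * hD
      have hrow : ∀ j : Fin (m + 1),
          (M 0 + (-(x ^ p * (x - t a))) • M 1) j.succ = 0 := fun j => by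
        have hj : mu (j.1 + 1) ≤ mu 0 := hmu 0 _ (by omega) (by omega)
        obtain ⟨s, hs⟩ := Nat.exists_eq_add_of_le (hj.trans hi1.le)
        have e0 : M 0 j.succ =
            x ^ (s + p) * ∏ r ∈ Finset.range (j.1 + 1), (x - t (a + r)) := by
          have : (lam 0 : ℤ) - mu (j.1 + 1) = (s + p : ℕ) := by omega
          simp only [hM, Matrix.of_apply, Fin.val_zero, Fin.val_succ, zero_add]
          rw [this, Dmulti_add_right, DopIter_powFun]
        have e1 : M 1 j.succ =
            x ^ s * ∏ r ∈ Finset.range j.1, (x - t (a + 1 + r)) := by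
          have : (lam 1 : ℤ) - mu (j.1 + 1) = (s : ℕ) := by omega
          simp only [hM, Matrix.of_apply, Fin.val_one, Fin.val_succ]
          rw [this, add_assoc j.1 1 a, add_comm 1 a, Dmulti_add_right, DopIter_powFun]
        have hprod : ∏ r ∈ Finset.range j.1, (x - t (a + (r + 1))) =
            ∏ r ∈ Finset.range j.1, (x - t (a + 1 + r)) :=
          Finset.prod_congr rfl fun r _ => by rw [add_assoc, add_comm 1 r]
        simp only [Pi.add_apply, Pi.smul_apply, smul_eq_mul, e0, e1]
        rw [Finset.prod_range_succ', hprod]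
        simp only [add_zero]
        ring
      have hmax : max (mu (0 : Fin (m + 1 + 1)).1)
          (if (0 : Fin (m + 1 + 1)).1 + 1 < m + 1 + 1 then
            lam ((0 : Fin (m + 1 + 1)).1 + 1) else 0) = lam 1 := by
        rw [Fin.val_zero]
        rw [if_pos (by omega)]
        exact max_eq_right hi1.le
      have hsub : (M.updateRow 0 (M 0 + (-(x ^ p * (x - t a))) • M 1)).submatrix
          Fin.succ Fin.succ = M.submatrix Fin.succ Fin.succ := by
        ext i j
        simp [Matrix.updateRow_apply]
      have hpow : powFun x ((lam 0 : ℤ) - lam 1) = x ^ p := by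
        rw [← powFun_natCast x p]
        congr 1
        omega
      rw [hmax, ← hdet, Matrix.det_succ_row_zero, Fin.sum_univ_succ]
      simp only [Matrix.updateRow_self, hrow, hrow0, Fin.val_zero, hpow,
        Fin.succAbove_zero, hsub]
      rw [show lam 1 - mu 0 = q by omega]
      simp [mul_comm]

/-- **One-variable determinant lemma for the LPP transition weights.**
With `v(ν) = x^ν` for `ν ≥ 0` and `v(ν) = 0` for `ν < 0`, and partitions
`λ, μ` with at most `ℓ` parts (`lam r`, `mu r` being `λ_{r+1}`, `μ_{r+1}`):
`det[ Δ_t^{j-i} v(λ_i - μ_j) ]_{i,j=1}^{ℓ}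
  = ∏_{j=1}^{ℓ} t_j^{max(μ_j, λ_{j+1}) - μ_j} v(λ_j - max(μ_j, λ_{j+1}))`,
where `λ_{ℓ+1} := 0`. -/
theorem det_difference_operators_factorizes
    {R : Type*} [CommRing R] (ℓ : ℕ) (hl : 1 ≤ ℓ) (t : ℕ → R) (x : R)
    (lam mu : ℕ → ℕ)
    (hlam : ∀ a b : ℕ, a ≤ b → b < ℓ → lam b ≤ lam a)
    (hmu : ∀ a b : ℕ, a ≤ b → b < ℓ → mu b ≤ mu a) :
    Matrix.det (Matrix.of fun i j : Fin ℓ =>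
        Dmulti t (i.1 + 1) (j.1 + 1)
          (fun ν => if 0 ≤ ν then x ^ ν.toNat else 0)
          ((lam i.1 : ℤ) - (mu j.1 : ℤ))) =
      ∏ j : Fin ℓ,
        t (j.1 + 1) ^
            (max (mu j.1) (if j.1 + 1 < ℓ then lam (j.1 + 1) else 0) - mu j.1) *
          (fun ν : ℤ => if 0 ≤ ν then x ^ ν.toNat else 0)
            ((lam j.1 : ℤ) -
              (max (mu j.1) (if j.1 + 1 < ℓ then lam (j.1 + 1) else 0) : ℤ)) := by
  have h := det_Dmulti_powFun ℓ 1 t x lam mu hlam hmu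
  push_cast at h
  exact h

end
end

section
/- Let μ ⊆ λ be partitions, each with at most ℓ parts, and let x = (x_1,…,x_n), t = (t_1,…,t_{ℓ−1}). Then the skew refined dual Grothendieck polynomial satisfies the Jacobi–Trudi formula g_{λ/μ}(x;t) = det[ Σ_{m=0}^{∞} α_m^{ij}(t) · h_{λ_i − μ_j − i + j − m}(x) ]_{i,j=1}^{ℓ}, where α_m^{ij}(t) = h_m(t_j, t_{j+1}, …, t_{i−1}) for i ≥ j (with the convention that h_m of an empty variable set is δ_{m,0}) and α_m^{ij}(t) = e_m(−t_i, −t_{i+1}, …, −t_{j−1}) for i < j; each inner sum has only finitely many nonzero terms, since h_d(x) = 0 for d < 0 and e_m of j−i variables vanishes for m > j−i. -/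
open scoped Classical

noncomputable section

variable {R : Type*} [CommRing R]

/-- The boxes of the Young diagram with row lengths `lam 0, …, lam (ℓ-1)`
(a box in row `r < ℓ` and column `c < lam r`, both 0-indexed). -/
abbrev YBox (ℓ : ℕ) (lam : ℕ → ℕ) : Type := Σ r : Fin ℓ, Fin (lam r.1)

/-- A reverse plane partition of skew shape `lam/mu` with entries in `{1, …, n}`,
encoded as a filling of the boxes of `lam` by values in `Fin (n+1)`, where the
value `0` is used exactly on the boxes of `mu`; rows weakly increase and
columns weakly increase. -/
def IsSkewRPP (ℓ n : ℕ) (lam mu : ℕ → ℕ) (T : YBox ℓ lam → Fin (n + 1)) : Prop :=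
  (∀ b : YBox ℓ lam, ((T b : ℕ) = 0 ↔ (b.2 : ℕ) < mu b.1.1)) ∧
  (∀ (r : Fin ℓ) (c c' : Fin (lam r.1)), mu r.1 ≤ (c : ℕ) → (c : ℕ) ≤ (c' : ℕ) →
    T ⟨r, c⟩ ≤ T ⟨r, c'⟩) ∧
  (∀ (r r' : Fin ℓ) (c : Fin (lam r.1)) (c' : Fin (lam r'.1)),
    (r : ℕ) ≤ (r' : ℕ) → (c : ℕ) = (c' : ℕ) → mu r.1 ≤ (c : ℕ) → mu r'.1 ≤ (c' : ℕ) →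
    T ⟨r, c⟩ ≤ T ⟨r', c'⟩)

/-- The weight of a box `b` of the skew shape `lam/mu` in a reverse plane
partition `T`: it is `t (r+1)` (`r+1` being the 1-indexed row of `b`) if the box
directly below `b` exists (in `lam`) and carries the same entry, and `x e`
otherwise, where `e ∈ {1, …, n}` is the entry of `b`.  Boxes of `mu` have
weight `1`. -/
def boxWeight (ℓ n : ℕ) (lam mu : ℕ → ℕ) (x t : ℕ → R)
    (T : YBox ℓ lam → Fin (n + 1)) (b : YBox ℓ lam) : R :=
  if mu b.1.1 ≤ (b.2 : ℕ) then
    if ∃ (hr : (b.1 : ℕ) + 1 < ℓ) (hc : (b.2 : ℕ) < lam ((b.1 : ℕ) + 1)),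
        T ⟨⟨(b.1 : ℕ) + 1, hr⟩, ⟨(b.2 : ℕ), hc⟩⟩ = T b
      then t ((b.1 : ℕ) + 1)
      else x (T b : ℕ)
  else 1

/-- The (skew) refined dual Grothendieck polynomial `g_{lam/mu}(x; t)`:
the sum of `∏_r t_r^{b_r(T)} ∏_i x_i^{a_i(T)}` over all reverse plane
partitions `T` of shape `lam/mu` with entries in `{1, …, n}`, where `b_r(T)`
is the number of boxes in row `r` whose entry equals that of the box directly
below it, and `a_i(T)` is the number of columns containing the entry `i`. -/
def dualGroth (ℓ n : ℕ) (lam mu : ℕ → ℕ) (x t : ℕ → R) : R :=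
  ∑ T ∈ Finset.univ.filter (IsSkewRPP ℓ n lam mu),
    ∏ b : YBox ℓ lam, boxWeight ℓ n lam mu x t T b

/-- Complete homogeneous symmetric function `h_k` of the entries of a list. -/
def hL (k : ℕ) (L : List R) : R :=
  ∑ f ∈ Finset.univ.filter (fun f : Fin k → Fin L.length => Monotone f),
    ∏ i, L.get (f i)

/-- Elementary symmetric function `e_k` of the entries of a list. -/
def eL (k : ℕ) (L : List R) : R :=
  ∑ f ∈ Finset.univ.filter (fun f : Fin k → Fin L.length => StrictMono f),
    ∏ i, L.get (f i)

/-- `h_d` for an integer degree `d`, with `h_d = 0` for `d < 0`. -/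
def hInt (d : ℤ) (L : List R) : R := if 0 ≤ d then hL d.toNat L else 0

/-- `e_d` for an integer degree `d`, with `e_d = 0` for `d < 0`. -/
def eInt (d : ℤ) (L : List R) : R := if 0 ≤ d then eL d.toNat L else 0

/-- Extend a function on `Fin ℓ` to `ℕ` by `0`. -/
def extendFin (ℓ : ℕ) (p : Fin ℓ → ℕ) : ℕ → ℕ :=
  fun r => if h : r < ℓ then p ⟨r, h⟩ else 0

/-- A semistandard Young tableau of shape `lam` with entries in `{1, …, N}`
(encoded with values in `Fin (N+1)`, the value `0` being unused): rows weakly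
increase and columns strictly increase. -/
def IsSSYT (ℓ N : ℕ) (lam : ℕ → ℕ) (T : YBox ℓ lam → Fin (N + 1)) : Prop :=
  (∀ b : YBox ℓ lam, 1 ≤ (T b : ℕ)) ∧
  (∀ (r : Fin ℓ) (c c' : Fin (lam r.1)), (c : ℕ) ≤ (c' : ℕ) → T ⟨r, c⟩ ≤ T ⟨r, c'⟩) ∧
  (∀ (r r' : Fin ℓ) (c : Fin (lam r.1)) (c' : Fin (lam r'.1)),
    (r : ℕ) < (r' : ℕ) → (c : ℕ) = (c' : ℕ) → T ⟨r, c⟩ < T ⟨r', c'⟩)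

/-- The Schur polynomial `s_lam (z 1, …, z N)`: the sum of `z^T` over all
semistandard Young tableaux of shape `lam` with entries in `{1, …, N}`. -/
def schurPoly (ℓ N : ℕ) (lam : ℕ → ℕ) (z : ℕ → R) : R :=
  ∑ T ∈ Finset.univ.filter (IsSSYT ℓ N lam),
    ∏ b : YBox ℓ lam, z (T b : ℕ)


open PowerSeries in
/-- The geometric series `1 / (1 - y X)`. -/
def geomSeries (y : R) : PowerSeries R := PowerSeries.mk fun k => y ^ k

open PowerSeries in
lemma geomSeries_mul_one_sub (y : R) : geomSeries y * (1 - C y * X) = 1 := by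
  ext k
  rcases k with _ | k
  · simp [geomSeries, mul_sub]
  · rw [mul_sub, mul_one, ← mul_assoc, map_sub, coeff_succ_mul_X, mul_comm (geomSeries y),
      coeff_C_mul]
    simp [geomSeries, coeff_one, pow_succ']

lemma hL_zero (L : List R) : hL 0 L = 1 := by
  simp [hL, Finset.filter_true_of_mem, Subsingleton.monotone]

lemma eL_zero (L : List R) : eL 0 L = 1 := by
  simp [eL, Finset.filter_true_of_mem, Subsingleton.strictMono]

lemma hL_succ_nil (k : ℕ) : hL (k + 1) ([] : List R) = 0 := by
  refine Finset.sum_eq_zero fun f _ => (f 0).elim0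

lemma eL_eq_zero (k : ℕ) (L : List R) (h : L.length < k) : eL k L = 0 := by
  refine Finset.sum_eq_zero fun f hf => ?_
  have := Fintype.card_le_of_injective f (Finset.mem_filter.1 hf).2.injective
  simp at this
  omega

lemma exists_succ_comp_eq {k m : ℕ} (f : Fin (k + 1) → Fin (m + 1)) (hf : Monotone f)
    (h0 : f 0 ≠ 0) : ∃ g : Fin (k + 1) → Fin m, (fun i => (g i).succ) = f := by
  have h (i) : f i ≠ 0 := fun h => h0 (le_antisymm (h ▸ hf (Fin.zero_le i)) (Fin.zero_le _))
  exact ⟨fun i => (f i).pred (h i), by simp⟩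

lemma hL_succ_cons (k : ℕ) (a : R) (L : List R) :
    hL (k + 1) (a :: L) = a * hL k (a :: L) + hL (k + 1) L := by
  unfold hL
  rw [← Finset.sum_filter_add_sum_filter_not _ (fun f => f 0 = (0 : Fin (L.length + 1))),
    Finset.mul_sum]
  congr 1
  · refine Finset.sum_nbij' (fun f i => f i.succ)
      (fun f => Fin.cons (0 : Fin (L.length + 1)) f) ?_ ?_ ?_ ?_ ?_
    · intro f hf
      simp only [Finset.mem_filter, Finset.mem_univ, true_and] at hf ⊢
      exact fun i j h => hf.1 (Fin.succ_le_succ_iff.2 h)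
    · intro f hf
      simp only [Finset.mem_filter, Finset.mem_univ, true_and, Fin.cons_zero, and_true] at hf ⊢
      intro i j h
      induction i using Fin.cases with
      | zero => exact Fin.zero_le (n := L.length + 1) _
      | succ i =>
        induction j using Fin.cases with
        | zero => simp at h
        | succ j => simpa using hf (Fin.succ_le_succ_iff.1 h)
    · intro f hf
      simp only [Finset.mem_filter, Finset.mem_univ, true_and] at hf
      ext i
      induction i using Fin.cases with
      | zero => simp [hf.2]
      | succ i => simp
    · intro f hf
      ext i
      simp
    · intro f hf
      simp only [Finset.mem_filter, Finset.mem_univ, true_and] at hf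
      rw [Fin.prod_univ_succ, hf.2]
      rfl
  · symm
    refine Finset.sum_nbij (fun f i => Fin.succ (n := L.length) (f i)) ?_ ?_ ?_ ?_
    · intro f hf
      simp only [Finset.mem_filter, Finset.mem_univ, true_and] at hf ⊢
      exact ⟨fun i j h => Fin.succ_le_succ_iff.2 (hf h), Fin.succ_ne_zero _⟩
    · intro f _ g _ h
      ext i
      simpa using congrArg Fin.val (congrFun h i)
    · intro f hf
      simp only [Finset.coe_filter, Finset.mem_filter, Finset.mem_univ, true_and,
        Set.mem_ofPred_eq] at hf
      obtain ⟨g, rfl⟩ := exists_succ_comp_eq f hf.1 hf.2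
      refine ⟨g, ?_, rfl⟩
      simp only [Finset.coe_filter, Finset.mem_univ, true_and, Set.mem_ofPred_eq]
      exact fun i j h => Fin.succ_le_succ_iff.1 (hf.1 h)
    · intro f _
      rfl

lemma eL_succ_cons (k : ℕ) (a : R) (L : List R) :
    eL (k + 1) (a :: L) = a * eL k L + eL (k + 1) L := by
  unfold eL
  rw [← Finset.sum_filter_add_sum_filter_not _ (fun f => f 0 = (0 : Fin (L.length + 1))),
    Finset.mul_sum]
  congr 1
  · symm
    refine Finset.sum_nbij (fun f => Fin.cons (0 : Fin (L.length + 1))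
      fun i => Fin.succ (n := L.length) (f i)) ?_ ?_ ?_ ?_
    · intro f hf
      simp only [Finset.mem_filter, Finset.mem_univ, true_and, Fin.cons_zero, and_true] at hf ⊢
      intro i j h
      induction j using Fin.cases with
      | zero => simp at h
      | succ j =>
        induction i using Fin.cases with
        | zero => simp
        | succ i => simpa using hf (Fin.succ_lt_succ_iff.1 h)
    · intro f _ g _ h
      ext i
      simpa using congrArg Fin.val (congrFun h i.succ)
    · intro f hf
      simp only [Finset.coe_filter, Finset.mem_filter, Finset.mem_univ, true_and,
        Set.mem_ofPred_eq] at hf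
      have h (i : Fin k) : f i.succ ≠ (0 : Fin (L.length + 1)) :=
        ((Fin.zero_le _).trans_lt (hf.1 (Fin.succ_pos i))).ne'
      refine ⟨fun i => Fin.pred (n := L.length) (f i.succ) (h i), ?_, ?_⟩
      · simp only [Finset.coe_filter, Finset.mem_univ, true_and, Set.mem_ofPred_eq]
        exact fun i j hij => Fin.pred_lt_pred_iff.2 (hf.1 (Fin.succ_lt_succ_iff.2 hij))
      · ext i
        induction i using Fin.cases with
        | zero => simp [hf.2]
        | succ i => simp
    · intro f _
      rw [Fin.prod_univ_succ]
      rfl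
  · symm
    refine Finset.sum_nbij (fun f i => Fin.succ (n := L.length) (f i)) ?_ ?_ ?_ ?_
    · intro f hf
      simp only [Finset.mem_filter, Finset.mem_univ, true_and] at hf ⊢
      exact ⟨fun i j h => Fin.succ_lt_succ_iff.2 (hf h), Fin.succ_ne_zero _⟩
    · intro f _ g _ h
      ext i
      simpa using congrArg Fin.val (congrFun h i)
    · intro f hf
      simp only [Finset.coe_filter, Finset.mem_filter, Finset.mem_univ, true_and,
        Set.mem_ofPred_eq] at hf
      obtain ⟨g, rfl⟩ := exists_succ_comp_eq f hf.1.monotone hf.2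
      refine ⟨g, ?_, rfl⟩
      simp only [Finset.coe_filter, Finset.mem_univ, true_and, Set.mem_ofPred_eq]
      exact fun i j h => Fin.succ_lt_succ_iff.1 (hf.1 h)
    · intro f _
      rfl

open PowerSeries in
lemma mk_hL (L : List R) : PowerSeries.mk (fun k => hL k L) = (L.map geomSeries).prod := by
  induction L with
  | nil =>
    ext k
    rcases k with _ | k <;> simp [hL_zero, hL_succ_nil, coeff_one]
  | cons a L ih =>
    have h : PowerSeries.mk (fun k => hL k (a :: L)) * (1 - C a * X) =
        PowerSeries.mk fun k => hL k L := by
      ext k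
      rcases k with _ | k
      · simp [mul_sub, hL_zero]
      · rw [mul_sub, mul_one, ← mul_assoc, map_sub, coeff_succ_mul_X, mul_comm _ (C a),
          coeff_C_mul]
        simp [hL_succ_cons]
    rw [List.map_cons, List.prod_cons, ← ih, ← h, mul_left_comm, geomSeries_mul_one_sub, mul_one]

open PowerSeries in
lemma mk_eL (L : List R) :
    PowerSeries.mk (fun k => eL k L) = (L.map fun y => 1 + C y * X).prod := by
  induction L with
  | nil =>
    ext k
    rcases k with _ | k <;> simp [eL_zero, eL_eq_zero, coeff_one]
  | cons a L ih =>
    rw [List.map_cons, List.prod_cons, ← ih]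
    ext k
    rcases k with _ | k
    · simp [add_mul, eL_zero]
    · rw [add_mul, one_mul, mul_assoc, map_add, coeff_C_mul, coeff_succ_X_mul]
      simp [eL_succ_cons, add_comm]

/-- The sum of `g b` over the starting points `b ≤ a` of a path from `b` to `a` with unit steps,
the step from `k` to `k + 1` having weight `u k`. -/
def stepSum (u g : ℕ → R) (a : ℕ) : R :=
  ∑ b ∈ Finset.range (a + 1), (∏ k ∈ Finset.Ico b a, u k) * g b

lemma stepSum_zero (u g : ℕ → R) : stepSum u g 0 = g 0 := by
  simp [stepSum]

lemma stepSum_succ (u g : ℕ → R) (a : ℕ) :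
    stepSum u g (a + 1) = g (a + 1) + u a * stepSum u g a := by
  unfold stepSum
  rw [Finset.sum_range_succ, add_comm, Finset.mul_sum]
  congr 1
  · simp
  · refine Finset.sum_congr rfl fun b hb => ?_
    rw [Finset.prod_Ico_succ_top (by simpa [Nat.lt_succ_iff] using hb)]
    ring

lemma sum_range_prod_Ico_mul (u g : ℕ → R) {c a : ℕ} (hca : c ≤ a) :
    ∑ b ∈ Finset.range (c + 1), (∏ k ∈ Finset.Ico b a, u k) * g b =
      (∏ k ∈ Finset.Ico c a, u k) * stepSum u g c := by
  rw [stepSum, Finset.mul_sum]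
  refine Finset.sum_congr rfl fun b hb => ?_
  rw [← Finset.prod_Ico_consecutive u (by simpa [Nat.lt_succ_iff] using hb) hca]
  ring

open PowerSeries in
lemma coeff_succ_one_sub_mul (y : R) (p : PowerSeries R) (a : ℕ) :
    coeff (a + 1) ((1 - C y * X) * p) = coeff (a + 1) p - y * coeff a p := by
  rw [sub_mul, one_mul, mul_assoc, map_sub, coeff_C_mul, coeff_succ_X_mul]

open PowerSeries in
lemma stepSum_coeff_one_sub_mul (u : ℕ → R) (y : R) (p : PowerSeries R) (a : ℕ)
    (hu : ∀ k < a, u k = y) :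
    stepSum u (fun b => coeff b ((1 - C y * X) * p)) a = coeff a p := by
  induction a with
  | zero => simp [stepSum_zero, sub_mul]
  | succ a ih =>
    rw [stepSum_succ, ih fun k hk => hu k (by omega), hu a (by omega), coeff_succ_one_sub_mul]
    ring

open PowerSeries in
lemma stepSum_coeff_eq_coeff_mul_geomSeries (y : R) (q : PowerSeries R) (a : ℕ) :
    stepSum (fun _ => y) (fun b => coeff b q) a = coeff a (q * geomSeries y) := by
  rw [← stepSum_coeff_one_sub_mul (fun _ => y) y (q * geomSeries y) a fun _ _ => rfl,
    mul_left_comm, mul_comm (1 - C y * X), geomSeries_mul_one_sub, mul_one]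

open PowerSeries in
lemma coeff_one_sub_mul_geomSeries (u : ℕ → R) (x y : R) (p : PowerSeries R) (c d : ℕ)
    (hy : ∀ k ≤ c, u k = y) (hx : ∀ k, c < k → u k = x) :
    coeff (c + 1 + d) ((1 - C y * X) * p * geomSeries x) =
      stepSum u (fun b => coeff b ((1 - C y * X) * p)) (c + 1 + d) +
        x ^ d * (x - y) * coeff c (p * geomSeries x) := by
  have hg (q : PowerSeries R) (a : ℕ) : coeff (a + 1) (q * geomSeries x) =
      coeff (a + 1) q + x * coeff a (q * geomSeries x) := by
    simp only [← stepSum_coeff_eq_coeff_mul_geomSeries, stepSum_succ]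
  induction d with
  | zero =>
    rw [add_zero, stepSum_coeff_one_sub_mul u y p _ fun k hk => hy k (by omega), mul_assoc,
      coeff_succ_one_sub_mul, hg]
    ring
  | succ d ih =>
    rw [← add_assoc, stepSum_succ, hg, ih, hx _ (by omega)]
    ring

lemma sum_strictAnti_succ {W : Type*} [AddCommMonoid W] (ℓ : ℕ) (A : ℕ → ℕ)
    (F : (Fin (ℓ + 1) → ℕ) → W) :
    ∑ B ∈ (Fintype.piFinset fun i : Fin (ℓ + 1) => Finset.range (A i + 1)).filter StrictAnti,
        F B =
      ∑ B ∈ (Fintype.piFinset fun i : Fin ℓ => Finset.range (A (i + 1) + 1)).filter StrictAnti,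
        ∑ b ∈ (Finset.range (A 0 + 1)).filter (fun b => ∀ i, B i < b), F (Fin.cons b B) := by
  rw [Finset.sum_sigma']
  refine Finset.sum_nbij' (fun B => ⟨fun i => B i.succ, B 0⟩) (fun B => Fin.cons B.2 B.1)
    ?_ ?_ ?_ ?_ ?_
  · intro B hB
    simp only [Finset.mem_filter, Fintype.mem_piFinset, Finset.mem_range, Finset.mem_sigma]
      at hB ⊢
    exact ⟨⟨fun i => hB.1 i.succ, fun i j h => hB.2 (Fin.succ_lt_succ_iff.2 h)⟩, hB.1 0,
      fun i => hB.2 (Fin.succ_pos i)⟩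
  · rintro ⟨B, b⟩ hB
    simp only [Finset.mem_filter, Fintype.mem_piFinset, Finset.mem_range, Finset.mem_sigma]
      at hB ⊢
    refine ⟨fun i => ?_, fun i j h => ?_⟩
    · induction i using Fin.cases with
      | zero => simpa using hB.2.1
      | succ i => simpa using hB.1.1 i
    · induction j using Fin.cases with
      | zero => simp at h
      | succ j =>
        induction i using Fin.cases with
        | zero => simpa using hB.2.2 j
        | succ i => simpa using hB.1.2 (Fin.succ_lt_succ_iff.1 h)
  · intro B _
    exact Fin.cons_self_tail B
  · rintro ⟨B, b⟩ _
    simp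
  · intro B _
    exact congrArg F (Fin.cons_self_tail B).symm

/-- Expansion of an alternating map over strictly decreasing sequences, when each argument `L i` is
a combination of the vectors `v i b` modulo the next argument, and each short initial segment of
that combination is proportional to a vector `v (i + 1) c`. -/
lemma AlternatingMap.eq_sum_strictAnti {V W : Type*} [AddCommGroup V] [Module R V]
    [AddCommGroup W] [Module R W] (ℓ : ℕ) (f : V [⋀^Fin ℓ]→ₗ[R] W) (A : ℕ → ℕ)
    (φ : ℕ → ℕ → R) (v : ℕ → ℕ → V) (L : ℕ → V)
    (hA : ∀ i, i + 1 < ℓ → A (i + 1) < A i)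
    (hL : ∀ i, i + 1 < ℓ → ∃ κ : R,
      L i = ∑ b ∈ Finset.range (A i + 1), φ i b • v i b + κ • L (i + 1))
    (hlast : ∀ i, i + 1 = ℓ → L i = ∑ b ∈ Finset.range (A i + 1), φ i b • v i b)
    (hv : ∀ i, i + 1 < ℓ → ∀ c ≤ A (i + 1), ∃ κ : R,
      ∑ b ∈ Finset.range (c + 1), φ i b • v i b = κ • v (i + 1) c) :
    f (fun i => L i) =
      ∑ B ∈ (Fintype.piFinset fun i : Fin ℓ => Finset.range (A i + 1)).filter StrictAnti,
        (∏ i : Fin ℓ, φ i (B i)) • f (fun i => v i (B i)) := by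
  induction ℓ generalizing A φ v L with
  | zero =>
    simp [Finset.filter_true_of_mem, Subsingleton.strictAnti]
    congr 1
    exact Subsingleton.elim _ _
  | succ ℓ ih =>
    have hcons (w : ℕ → V) :
        (fun i : Fin (ℓ + 1) => w i) = Matrix.vecCons (w 0) fun i : Fin ℓ => w (i + 1) := by
      ext i
      induction i using Fin.cases <;> simp
    have hself (w : V) (g : Fin ℓ → V) (i : Fin ℓ) (κ : R) (h : w = κ • g i) :
        f.curryLeft w g = 0 := by
      rw [h, map_smul, AlternatingMap.smul_apply, AlternatingMap.curryLeft_apply_apply,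
        f.map_eq_zero_of_eq _ (i := 0) (j := i.succ) (by simp) (Fin.succ_ne_zero i).symm,
        smul_zero]
    rw [hcons, ← AlternatingMap.curryLeft_apply_apply, sum_strictAnti_succ]
    have h1 : f.curryLeft (L 0) (fun i : Fin ℓ => L (i + 1)) =
        f.curryLeft (∑ b ∈ Finset.range (A 0 + 1), φ 0 b • v 0 b)
          (fun i : Fin ℓ => L (i + 1)) := by
      rcases Nat.eq_zero_or_pos ℓ with rfl | hpos
      · rw [hlast 0 rfl]
      · obtain ⟨κ, hκ⟩ := hL 0 (by omega)
        rw [hκ, map_add, AlternatingMap.add_apply, hself (κ • L (0 + 1)) _ ⟨0, hpos⟩ κ rfl,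
          add_zero]
    rw [h1, ih (f.curryLeft _) (fun i => A (i + 1)) (fun i => φ (i + 1)) (fun i => v (i + 1))
      (fun i => L (i + 1)) (fun i hi => hA _ (by omega)) (fun i hi => hL _ (by omega))
      (fun i hi => hlast _ (by omega)) (fun i hi => hv _ (by omega))]
    refine Finset.sum_congr rfl fun B hB => ?_
    simp only [Finset.mem_filter, Fintype.mem_piFinset, Finset.mem_range] at hB
    have h2 : f.curryLeft (∑ b ∈ Finset.range (A 0 + 1), φ 0 b • v 0 b)
          (fun i : Fin ℓ => v (i + 1) (B i)) =
        f.curryLeft (∑ b ∈ (Finset.range (A 0 + 1)).filter (fun b => ∀ i, B i < b),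
          φ 0 b • v 0 b) (fun i : Fin ℓ => v (i + 1) (B i)) := by
      rw [← Finset.sum_filter_add_sum_filter_not _ (fun b => ∀ i, B i < b), map_add,
        AlternatingMap.add_apply, add_eq_left]
      rcases Nat.eq_zero_or_pos ℓ with rfl | hpos
      · simp
      · have hlt : B ⟨0, hpos⟩ < A 0 := by
          have h3 := hB.1 ⟨0, hpos⟩
          have h4 := hA 0 (by omega)
          simp only [zero_add] at h3 h4
          omega
        have h5 : (Finset.range (A 0 + 1)).filter (fun b => ¬ ∀ i, B i < b) =
            Finset.range (B ⟨0, hpos⟩ + 1) := by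
          ext b
          simp only [Finset.mem_filter, Finset.mem_range, not_forall, not_lt]
          constructor
          · rintro ⟨_, i, hi⟩
            have := hB.2.antitone (show (⟨0, hpos⟩ : Fin ℓ) ≤ i from Nat.zero_le _)
            omega
          · intro h
            exact ⟨by omega, ⟨0, hpos⟩, by omega⟩
        obtain ⟨κ, hκ⟩ := hv 0 (by omega) (B ⟨0, hpos⟩)
          (by have := hB.1 ⟨0, hpos⟩; simp only [zero_add] at this ⊢; omega)
        rw [h5]
        exact hself _ _ ⟨0, hpos⟩ κ hκ
    have hsum := map_sum (AddMonoidHom.mk' (fun w => f.curryLeft w fun i => v (i + 1) (B i))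
      fun w w' => by rw [map_add, AlternatingMap.add_apply]) (fun b => φ 0 b • v 0 b)
      ((Finset.range (A 0 + 1)).filter fun b => ∀ i, B i < b)
    simp only [AddMonoidHom.mk'_apply] at hsum
    rw [h2, hsum, Finset.smul_sum]
    refine Finset.sum_congr rfl fun b _ => ?_
    rw [map_smul, AlternatingMap.smul_apply, AlternatingMap.curryLeft_apply_apply,
      Fin.prod_univ_succ, smul_smul]
    congr 1
    · simp [mul_comm]
    · congr 1
      ext i
      induction i using Fin.cases <;> simp

open PowerSeries in
/-- The determinant of the coefficients of degree `A i` in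
`X ^ (mu j + (ℓ - 1 - j)) * ∏ k < j, (1 - t (k + 1) X) / ∏ k < i, (1 - t (k + 1) X)` times the
generating series of the complete homogeneous polynomials in `x 1, …, x n`. -/
def jacobiTrudiDet (ℓ n : ℕ) (mu : ℕ → ℕ) (x t : ℕ → R) (A : Fin ℓ → ℕ) : R :=
  Matrix.det (Matrix.of fun i j : Fin ℓ => coeff (A i)
    ((∏ k ∈ Finset.range i, geomSeries (t (k + 1))) *
      (X ^ (mu j + (ℓ - 1 - j)) * (∏ k ∈ Finset.range j, (1 - C (t (k + 1)) * X)) *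
        ∏ k ∈ Finset.range n, geomSeries (x (k + 1)))))

open PowerSeries in
lemma jacobiTrudiDet_succ (ℓ n : ℕ) (mu : ℕ → ℕ) (x t : ℕ → R) (A : ℕ → ℕ)
    (hA : ∀ i, i + 1 < ℓ → A (i + 1) < A i) :
    jacobiTrudiDet ℓ (n + 1) mu x t (fun i => A i) =
      ∑ B ∈ (Fintype.piFinset fun i : Fin ℓ => Finset.range (A i + 1)).filter StrictAnti,
        (∏ i : Fin ℓ, ∏ k ∈ Finset.Ico (B i) (A i),
          if (i : ℕ) + 1 < ℓ ∧ k ≤ A (i + 1) then t (i + 1) else x (n + 1)) *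
          jacobiTrudiDet ℓ n mu x t B := by
  set Q : ℕ → PowerSeries R := fun i => ∏ k ∈ Finset.range i, geomSeries (t (k + 1)) with hQ
  set F : Fin ℓ → PowerSeries R := fun j => X ^ (mu j + (ℓ - 1 - j)) *
    (∏ k ∈ Finset.range j, (1 - C (t (k + 1)) * X)) *
        ∏ k ∈ Finset.range n, geomSeries (x (k + 1)) with hF
  have hQs (i : ℕ) (f : PowerSeries R) :
      Q i * f = (1 - C (t (i + 1)) * X) * (Q (i + 1) * f) := by
    simp only [hQ, Finset.prod_range_succ]
    rw [← mul_assoc, mul_left_comm, mul_comm (1 - C (t (i + 1)) * X), geomSeries_mul_one_sub,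
      mul_one]
  set u : ℕ → ℕ → R := fun i k => if i + 1 < ℓ ∧ k ≤ A (i + 1) then t (i + 1) else x (n + 1)
    with hu
  have hut (i : ℕ) (hi : i + 1 < ℓ) (k : ℕ) (hk : k ≤ A (i + 1)) : u i k = t (i + 1) :=
    if_pos ⟨hi, hk⟩
  have hux (i : ℕ) (k : ℕ) (hk : A (i + 1) < k) : u i k = x (n + 1) :=
    if_neg fun h => by omega
  have key := AlternatingMap.eq_sum_strictAnti ℓ
    (Matrix.detRowAlternating (R := R) (n := Fin ℓ)) A
    (fun i b => ∏ k ∈ Finset.Ico b (A i), u i k)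
    (fun i b j => coeff b (Q i * F j))
    (fun i j => coeff (A i) (Q i * F j * geomSeries (x (n + 1)))) hA ?_ ?_ ?_
  · simp only [hQ, hF, ← mul_assoc] at key
    simp only [jacobiTrudiDet, Finset.prod_range_succ, ← mul_assoc]
    exact key
  · intro i hi
    obtain ⟨d, hd⟩ := Nat.exists_eq_add_of_lt (hA i hi)
    refine ⟨x (n + 1) ^ d * (x (n + 1) - t (i + 1)), ?_⟩
    ext j
    have := coeff_one_sub_mul_geomSeries (u i) (x (n + 1)) (t (i + 1)) (Q (i + 1) * F j)
      (A (i + 1)) d (hut i hi) (hux i)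
    rw [← hQs, show A (i + 1) + 1 + d = A i by omega] at this
    simpa [stepSum, Finset.sum_apply] using this
  · intro i hi
    ext j
    have h : u i = fun _ => x (n + 1) := by
      ext k
      exact if_neg fun h => by omega
    have := stepSum_coeff_eq_coeff_mul_geomSeries (x (n + 1)) (Q i * F j) (A i)
    rw [← h] at this
    simpa [stepSum, Finset.sum_apply] using this.symm
  · intro i hi c hc
    refine ⟨∏ k ∈ Finset.Ico c (A i), u i k, ?_⟩
    ext j
    have := sum_range_prod_Ico_mul (u i) (fun b => coeff b (Q i * F j))
      (hc.trans (hA i hi).le)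
    simp only [hQs i] at this
    rw [stepSum_coeff_one_sub_mul _ _ _ _ fun k hk => hut i hi k (by omega)] at this
    simpa [Finset.sum_apply, hQs i] using this

lemma add_sub_le_of_strictAnti {ℓ : ℕ} {B : Fin ℓ → ℕ} (hB : StrictAnti B) {i j : Fin ℓ}
    (h : i ≤ j) : B j + (j - i : ℕ) ≤ B i := by
  obtain ⟨d, hd⟩ := Nat.exists_eq_add_of_le (Fin.le_def.1 h)
  induction d generalizing j with
  | zero =>
    obtain rfl : j = i := Fin.ext hd
    simp
  | succ d ih =>
    have hlt : (i : ℕ) + d < ℓ := by omega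
    have h1 := @ih ⟨i + d, hlt⟩ (Fin.le_def.2 (by simp)) rfl
    have h2 : B j < B ⟨i + d, hlt⟩ := hB (Fin.lt_def.2 (show (i : ℕ) + d < j by omega))
    simp only at h1
    omega

lemma sum_strictAnti_eq_sum_antitone {W : Type*} [AddCommMonoid W] (ℓ : ℕ) (lam : ℕ → ℕ)
    (F : (Fin ℓ → ℕ) → W) :
    ∑ B ∈ (Fintype.piFinset fun i : Fin ℓ => Finset.range (lam i + (ℓ - 1 - i) + 1)).filter
        StrictAnti, F B =
      ∑ ν ∈ (Fintype.piFinset fun i : Fin ℓ => Finset.range (lam i + 1)).filter Antitone,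
        F (fun i => ν i + (ℓ - 1 - i)) := by
  have hle {B : Fin ℓ → ℕ} (hB : StrictAnti B) (i : Fin ℓ) : ℓ - 1 - i ≤ B i := by
    have h := add_sub_le_of_strictAnti hB (i := i) (j := ⟨ℓ - 1, by have := i.2; omega⟩)
      (Fin.le_def.2 (by simp only; omega))
    simp only at h
    omega
  refine Finset.sum_nbij' (fun B i => B i - (ℓ - 1 - i)) (fun ν i => ν i + (ℓ - 1 - i))
    ?_ ?_ ?_ ?_ ?_
  · intro B hB
    simp only [Finset.mem_filter, Fintype.mem_piFinset, Finset.mem_range] at hB ⊢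
    refine ⟨fun i => ?_, fun i j h => ?_⟩
    · have := hB.1 i
      have := hle hB.2 i
      omega
    · have := add_sub_le_of_strictAnti hB.2 h
      have := hle hB.2 i
      have := hle hB.2 j
      have := Fin.le_def.1 h
      dsimp only
      omega
  · intro ν hν
    simp only [Finset.mem_filter, Fintype.mem_piFinset, Finset.mem_range] at hν ⊢
    refine ⟨fun i => ?_, fun i j h => ?_⟩
    · have := hν.1 i
      omega
    · have := hν.2 h.le
      have := Fin.lt_def.1 h
      dsimp only
      omega
  · intro B hB
    ext i
    have := hle (Finset.mem_filter.1 hB).2 i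
    dsimp only
    omega
  · intro ν _
    ext i
    simp
  · intro B hB
    congr 1
    ext i
    have := hle (Finset.mem_filter.1 hB).2 i
    dsimp only
    omega

lemma det_eq_zero_of_block {ℓ : ℕ} (M : Matrix (Fin ℓ) (Fin ℓ) R) (i : Fin ℓ)
    (h : ∀ r c, i ≤ r → c ≤ i → M r c = 0) : M.det = 0 := by
  rw [Matrix.det_apply]
  refine Finset.sum_eq_zero fun σ _ => ?_
  obtain ⟨c, hc, hr⟩ : ∃ c ≤ i, i ≤ σ c := by
    by_contra! hcon
    have := Finset.card_le_card_of_injOn (s := Finset.Iic i) (t := Finset.Iio i) σ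
      (fun c hc => by simpa using hcon c (by simpa using hc)) σ.injective.injOn
    simp at this
  exact smul_eq_zero_of_right _ (Finset.prod_eq_zero (Finset.mem_univ c) (h _ _ hr hc))

open PowerSeries in
lemma jacobiTrudiDet_eq_zero (ℓ n : ℕ) (mu : ℕ → ℕ) (x t : ℕ → R) (ν : Fin ℓ → ℕ)
    (hmu : ∀ a b : ℕ, a ≤ b → b < ℓ → mu b ≤ mu a) (hν : Antitone ν) (i : Fin ℓ)
    (hi : ν i < mu i) :
    jacobiTrudiDet ℓ n mu x t (fun i => ν i + (ℓ - 1 - i)) = 0 := by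
  refine det_eq_zero_of_block _ i fun r c hr hc => ?_
  have h1 := hν hr
  have h2 := hmu c i hc i.2
  have h3 : (i : ℕ) ≤ r := hr
  have h4 : (c : ℕ) ≤ i := hc
  simp only [Matrix.of_apply]
  rw [mul_assoc, mul_left_comm, coeff_X_pow_mul', if_neg (by omega)]

lemma prod_map_list_range {M : Type*} [CommMonoid M] (f : ℕ → M) (n : ℕ) :
    ((List.range n).map f).prod = ∏ k ∈ Finset.range n, f k := by
  rw [Finset.prod, Finset.range_val, Multiset.range, Multiset.map_coe, Multiset.prod_coe]

lemma prod_geomSeries_eq_mk_hL (x : ℕ → R) (n : ℕ) :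
    ∏ k ∈ Finset.range n, geomSeries (x k) =
      PowerSeries.mk fun k => hL k ((List.range n).map x) := by
  rw [mk_hL, List.map_map, prod_map_list_range]
  rfl

/-- The coefficient of degree `m` in
`∏ k < j, (1 - t (k + 1) X) / ∏ k < i, (1 - t (k + 1) X)`. -/
def ratioCoeff (t : ℕ → R) (i j m : ℕ) : R :=
  if j ≤ i then hL m ((List.range (i - j)).map fun a => t (j + 1 + a))
  else eL m ((List.range (j - i)).map fun a => -t (i + 1 + a))

open PowerSeries in
lemma prod_geomSeries_mul_prod_one_sub (t : ℕ → R) (i j : ℕ) :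
    (∏ k ∈ Finset.range i, geomSeries (t (k + 1))) *
      ∏ k ∈ Finset.range j, (1 - C (t (k + 1)) * X) = PowerSeries.mk (ratioCoeff t i j) := by
  have hinv (m : ℕ) : (∏ k ∈ Finset.range m, geomSeries (t (k + 1))) *
      ∏ k ∈ Finset.range m, (1 - C (t (k + 1)) * X) = 1 := by
    rw [← Finset.prod_mul_distrib]
    exact Finset.prod_eq_one fun k _ => geomSeries_mul_one_sub _
  rcases le_or_gt j i with h | h
  · obtain ⟨d, rfl⟩ := Nat.exists_eq_add_of_le h
    have : ratioCoeff t (j + d) j = fun m => hL m ((List.range d).map fun a => t (j + 1 + a)) := by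
      ext m
      simp [ratioCoeff]
    rw [this, ← prod_geomSeries_eq_mk_hL, Finset.prod_range_add, mul_right_comm, hinv, one_mul]
    exact Finset.prod_congr rfl fun k _ => by rw [add_right_comm]
  · obtain ⟨d, rfl⟩ := Nat.exists_eq_add_of_le h.le
    have : ratioCoeff t i (i + d) =
        fun m => eL m ((List.range d).map fun a => -t (i + 1 + a)) := by
      ext m
      rw [ratioCoeff, if_neg (by omega), Nat.add_sub_cancel_left]
    rw [this, mk_eL, Finset.prod_range_add, ← mul_assoc, hinv, one_mul, List.map_map,
      prod_map_list_range]
    refine Finset.prod_congr rfl fun k _ => ?_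
    simp [add_right_comm, sub_eq_add_neg]

open PowerSeries in
lemma coeff_jacobiTrudi_eq_finsum (ℓ n : ℕ) (mu : ℕ → ℕ) (x t : ℕ → R) (a : ℕ) (i j : Fin ℓ) :
    coeff (a + (ℓ - 1 - i)) ((∏ k ∈ Finset.range i, geomSeries (t (k + 1))) *
      (X ^ (mu j + (ℓ - 1 - j)) * (∏ k ∈ Finset.range j, (1 - C (t (k + 1)) * X)) *
        ∏ k ∈ Finset.range n, geomSeries (x (k + 1)))) =
      ∑ᶠ m : ℕ, ratioCoeff t i j m *
        hInt ((a : ℤ) - (mu j.1 : ℤ) - (i.1 : ℤ) + (j.1 : ℤ) - (m : ℤ))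
              ((List.range n).map fun a => x (a + 1)) := by
  rw [mul_assoc (X ^ _), mul_left_comm, ← mul_assoc (Finset.prod _ _),
    prod_geomSeries_mul_prod_one_sub, prod_geomSeries_eq_mk_hL (fun k => x (k + 1)),
    coeff_X_pow_mul', coeff_mul]
  have hi := i.2
  have hj := j.2
  split_ifs with h
  · obtain ⟨d, hd⟩ := Nat.exists_eq_add_of_le h
    rw [hd, Nat.add_sub_cancel_left, Finset.Nat.sum_antidiagonal_eq_sum_range_succ_mk,
      finsum_eq_sum_of_support_subset (s := Finset.range (d + 1))]
    · refine Finset.sum_congr rfl fun m hm => ?_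
      have hm' : m ≤ d := by simpa [Nat.lt_succ_iff] using hm
      rw [coeff_mk, coeff_mk, show (a : ℤ) - mu j - i + j - m = ((d - m : ℕ) : ℤ) by omega, hInt,
        if_pos (by positivity), Int.toNat_natCast]
    · intro m hm
      by_contra hcon
      refine hm ?_
      have : ¬ m < d + 1 := by simpa using hcon
      simp only [hInt]
      rw [if_neg (by omega), mul_zero]
  · symm
    refine finsum_eq_zero_of_forall_eq_zero fun m => ?_
    rw [hInt, if_neg (by omega), mul_zero]

lemma ratioCoeff_eq_zero (t : ℕ → R) {i j m : ℕ} (h : i ≤ j) (hm : j - i < m) :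
    ratioCoeff t i j m = 0 := by
  rw [ratioCoeff]
  split_ifs with h'
  · obtain rfl : i = j := le_antisymm h h'
    obtain ⟨m, rfl⟩ : ∃ k, m = k + 1 := ⟨m - 1, by omega⟩
    simpa using hL_succ_nil m
  · exact eL_eq_zero _ _ (by simpa using hm)

open PowerSeries in
lemma jacobiTrudiDet_zero (ℓ : ℕ) (lam mu : ℕ → ℕ) (x t : ℕ → R)
    (hlam : ∀ a b : ℕ, a ≤ b → b < ℓ → lam b ≤ lam a)
    (hmu : ∀ a b : ℕ, a ≤ b → b < ℓ → mu b ≤ mu a)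
    (hsub : ∀ r : ℕ, r < ℓ → mu r ≤ lam r) :
    jacobiTrudiDet ℓ 0 mu x t (fun i => lam i + (ℓ - 1 - i)) =
      if ∀ r < ℓ, lam r = mu r then 1 else 0 := by
  have hentry (i j : Fin ℓ) : coeff (lam i + (ℓ - 1 - i))
      ((∏ k ∈ Finset.range i, geomSeries (t (k + 1))) *
      (X ^ (mu j + (ℓ - 1 - j)) * (∏ k ∈ Finset.range j, (1 - C (t (k + 1)) * X)) *
        ∏ k ∈ Finset.range 0, geomSeries (x (k + 1)))) =
      if mu j + (ℓ - 1 - j) ≤ lam i + (ℓ - 1 - i) then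
        ratioCoeff t i j (lam i + (ℓ - 1 - i) - (mu j + (ℓ - 1 - j))) else 0 := by
    rw [Finset.range_zero, Finset.prod_empty, mul_one, mul_left_comm,
      prod_geomSeries_mul_prod_one_sub, coeff_X_pow_mul', coeff_mk]
  split_ifs with h
  · rw [jacobiTrudiDet, Matrix.det_of_isUpperTriangular]
    · refine Finset.prod_eq_one fun i _ => ?_
      rw [Matrix.of_apply, hentry, h i i.2]
      simp [ratioCoeff, hL_zero]
    · intro i j hij
      have hij' : (j : ℕ) < i := hij
      have := hmu j i hij'.le i.2
      have := i.2
      rw [Matrix.of_apply, hentry, h i i.2, if_neg (by omega)]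
  · push Not at h
    obtain ⟨r, hr, hne⟩ := h
    have hlt : mu r < lam r := lt_of_le_of_ne (hsub r hr) hne.symm
    rw [jacobiTrudiDet, ← Matrix.det_transpose]
    refine det_eq_zero_of_block _ ⟨r, hr⟩ fun c i hc hi => ?_
    have hc' : r ≤ c := hc
    have hi' : (i : ℕ) ≤ r := hi
    have := hmu r c hc c.2
    have := hlam i r hi hr
    have := c.2
    rw [Matrix.transpose_apply, Matrix.of_apply, hentry, if_pos (by omega),
      ratioCoeff_eq_zero t (hi'.trans hc') (by omega)]

lemma dualGroth_zero (ℓ : ℕ) (lam mu : ℕ → ℕ) (x t : ℕ → R)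
    (hsub : ∀ r : ℕ, r < ℓ → mu r ≤ lam r) :
    dualGroth ℓ 0 lam mu x t = if ∀ r < ℓ, lam r = mu r then 1 else 0 := by
  have hiff (T : YBox ℓ lam → Fin (0 + 1)) :
      IsSkewRPP ℓ 0 lam mu T ↔ ∀ r < ℓ, lam r = mu r := by
    constructor
    · intro h r hr
      refine le_antisymm ?_ (hsub r hr)
      by_contra! hlt
      have := (h.1 ⟨⟨r, hr⟩, ⟨mu r, hlt⟩⟩).1 (by simp)
      simp at this
    · intro h
      refine ⟨fun b => ⟨fun _ => ?_, fun _ => by simp⟩, fun _ _ _ _ _ => Fin.le_def.2 (by omega),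
        fun _ _ _ _ _ _ _ _ => Fin.le_def.2 (by omega)⟩
      rw [← h _ b.1.2]
      exact b.2.2
  unfold dualGroth
  simp only [hiff]
  split_ifs with h
  · have : Unique (Fin (0 + 1)) := inferInstanceAs (Unique (Fin 1))
    rw [Finset.filter_true_of_mem fun _ _ => h, Fintype.sum_unique]
    refine Finset.prod_eq_one fun b _ => ?_
    rw [boxWeight, if_neg]
    rw [← h _ b.1.2]
    exact not_le.2 b.2.2
  · rw [Finset.filter_false_of_mem fun _ _ => h, Finset.sum_empty]

/-- The boxes of `nu`, seen as boxes of the larger diagram `lam`. -/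
def YBox.incl {ℓ : ℕ} {nu lam : ℕ → ℕ} (h : ∀ r < ℓ, nu r ≤ lam r) (b : YBox ℓ nu) :
    YBox ℓ lam :=
  ⟨b.1, ⟨b.2, b.2.2.trans_le (h _ b.1.2)⟩⟩

/-- The restriction of a filling of `lam` to the boxes of `nu`, with values truncated at `n`. -/
def restrictFilling {ℓ : ℕ} (n : ℕ) {nu lam : ℕ → ℕ} (h : ∀ r < ℓ, nu r ≤ lam r)
    (T : YBox ℓ lam → Fin (n + 1 + 1)) (b : YBox ℓ nu) : Fin (n + 1) :=
  ⟨min (T (b.incl h)) n, by omega⟩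

/-- The extension of a filling of `nu` to `lam` by the value `n + 1`. -/
def extendFilling {ℓ : ℕ} (n : ℕ) {nu : ℕ → ℕ} (lam : ℕ → ℕ)
    (T : YBox ℓ nu → Fin (n + 1)) (b : YBox ℓ lam) : Fin (n + 1 + 1) :=
  if h : (b.2 : ℕ) < nu b.1 then (T ⟨b.1, ⟨b.2, h⟩⟩).castSucc else Fin.last (n + 1)

/-- The boxes of `T` with entries at most `n` are those of `nu`. -/
def HasInnerShape (ℓ n : ℕ) {lam : ℕ → ℕ} (T : YBox ℓ lam → Fin (n + 1 + 1)) (nu : ℕ → ℕ) : Prop :=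
  ∀ b : YBox ℓ lam, (T b : ℕ) ≤ n ↔ (b.2 : ℕ) < nu b.1

section Branching

variable {ℓ n : ℕ} {lam mu nu : ℕ → ℕ}

lemma HasInnerShape.restrictFilling_val {T : YBox ℓ lam → Fin (n + 1 + 1)}
    (hT : HasInnerShape ℓ n T nu) (h : ∀ r < ℓ, nu r ≤ lam r) (b : YBox ℓ nu) :
    (restrictFilling n h T b : ℕ) = T (b.incl h) :=
  min_eq_left ((hT (b.incl h)).2 b.2.2)

lemma hasInnerShape_extendFilling (T : YBox ℓ nu → Fin (n + 1)) :
    HasInnerShape ℓ n (extendFilling n lam T) nu := by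
  intro b
  rw [extendFilling]
  split_ifs with h
  · simpa [h] using Nat.lt_succ_iff.1 (T _).2
  · simp [h]

lemma restrictFilling_extendFilling (h : ∀ r < ℓ, nu r ≤ lam r) (T : YBox ℓ nu → Fin (n + 1)) :
    restrictFilling n h (extendFilling n lam T) = T := by
  ext b
  rw [(hasInnerShape_extendFilling T).restrictFilling_val, extendFilling]
  exact congrArg Fin.val (dif_pos b.2.2)

lemma HasInnerShape.extendFilling_restrictFilling {T : YBox ℓ lam → Fin (n + 1 + 1)}
    (hT : HasInnerShape ℓ n T nu) (h : ∀ r < ℓ, nu r ≤ lam r) :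
    extendFilling n lam (restrictFilling n h T) = T := by
  ext b
  rw [extendFilling]
  split_ifs with hb
  · exact hT.restrictFilling_val h _
  · have := (hT b).not.2 hb
    have := (T b).2
    simp only [Fin.val_last]
    omega

lemma IsSkewRPP.restrictFilling {T : YBox ℓ lam → Fin (n + 1 + 1)}
    (hR : IsSkewRPP ℓ (n + 1) lam mu T) (hT : HasInnerShape ℓ n T nu)
    (h : ∀ r < ℓ, nu r ≤ lam r) : IsSkewRPP ℓ n nu mu (restrictFilling n h T) := by
  refine ⟨fun b => ?_, fun r c c' hc hcc' => ?_, fun r r' c c' hr hcc' hc hc' => ?_⟩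
  · rw [hT.restrictFilling_val]
    exact hR.1 _
  · rw [Fin.le_def, hT.restrictFilling_val, hT.restrictFilling_val]
    exact hR.2.1 _ _ _ hc hcc'
  · rw [Fin.le_def, hT.restrictFilling_val, hT.restrictFilling_val]
    exact hR.2.2 _ _ _ _ hr hcc' hc hc'

lemma IsSkewRPP.extendFilling {T : YBox ℓ nu → Fin (n + 1)} (hR : IsSkewRPP ℓ n nu mu T)
    (hnu : ∀ a b : ℕ, a ≤ b → b < ℓ → nu b ≤ nu a) (hmunu : ∀ r < ℓ, mu r ≤ nu r) :
    IsSkewRPP ℓ (n + 1) lam mu (extendFilling n lam T) := by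
  have hle (b b' : YBox ℓ lam) (hb : (b'.2 : ℕ) < nu b'.1 → (b.2 : ℕ) < nu b.1)
      (hT : ∀ h h', T ⟨b.1, ⟨b.2, h⟩⟩ ≤ T ⟨b'.1, ⟨b'.2, h'⟩⟩) :
      _root_.extendFilling n lam T b ≤ _root_.extendFilling n lam T b' := by
    by_cases h' : (b'.2 : ℕ) < nu b'.1
    · simp only [_root_.extendFilling, dif_pos h', dif_pos (hb h')]
      exact Fin.castSucc_le_castSucc_iff.2 (hT _ _)
    · simp only [_root_.extendFilling, dif_neg h']
      exact Fin.le_last _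
  refine ⟨fun b => ?_, fun r c c' hc hcc' => ?_, fun r r' c c' hr hcc' hc hc' => ?_⟩
  · by_cases hb : (b.2 : ℕ) < nu b.1
    · simp only [_root_.extendFilling, dif_pos hb]
      exact hR.1 ⟨b.1, ⟨b.2, hb⟩⟩
    · simp only [_root_.extendFilling, dif_neg hb]
      have := hmunu b.1 b.1.2
      simp only [Fin.val_last]
      omega
  · exact hle _ _ (fun h => lt_of_le_of_lt hcc' h) fun _ _ => hR.2.1 _ _ _ hc hcc'
  · refine hle _ _ (fun h => ?_) fun _ _ => hR.2.2 _ _ _ _ hr hcc' hc hc'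
    have := hnu r r' hr r'.2
    simp only at h ⊢
    omega

lemma HasInnerShape.boxWeight_incl {T : YBox ℓ lam → Fin (n + 1 + 1)}
    (hT : HasInnerShape ℓ n T nu) (h : ∀ r < ℓ, nu r ≤ lam r) (x t : ℕ → R) (b : YBox ℓ nu) :
    boxWeight ℓ (n + 1) lam mu x t T (b.incl h) =
      boxWeight ℓ n nu mu x t (restrictFilling n h T) b := by
  have hb : (T (b.incl h) : ℕ) ≤ n := (hT _).2 b.2.2
  unfold boxWeight
  rw [hT.restrictFilling_val]
  refine if_congr Iff.rfl (if_congr ?_ rfl rfl) rfl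
  constructor
  · rintro ⟨hr, hc, he⟩
    refine ⟨hr, (hT ⟨⟨b.1 + 1, hr⟩, ⟨b.2, hc⟩⟩).1 (le_of_eq_of_le (congrArg Fin.val he) hb), ?_⟩
    rw [Fin.ext_iff, hT.restrictFilling_val, hT.restrictFilling_val]
    exact congrArg Fin.val he
  · rintro ⟨hr, hc, he⟩
    refine ⟨hr, hc.trans_le (h _ hr), ?_⟩
    rw [Fin.ext_iff, hT.restrictFilling_val, hT.restrictFilling_val] at he
    exact Fin.ext he

lemma HasInnerShape.boxWeight_of_le {T : YBox ℓ lam → Fin (n + 1 + 1)}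
    (hT : HasInnerShape ℓ n T nu) (hnu : ∀ a b : ℕ, a ≤ b → b < ℓ → nu b ≤ nu a)
    (hmunu : ∀ r < ℓ, mu r ≤ nu r) (x t : ℕ → R) (b : YBox ℓ lam) (hb : nu b.1 ≤ b.2) :
    boxWeight ℓ (n + 1) lam mu x t T b =
      if (b.1 : ℕ) + 1 < ℓ ∧ (b.2 : ℕ) < lam (b.1 + 1) then t (b.1 + 1) else x (n + 1) := by
  have hlast (b : YBox ℓ lam) (hb : nu b.1 ≤ b.2) : T b = Fin.last (n + 1) := by
    have := (hT b).not.2 hb.not_gt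
    have := (T b).2
    exact Fin.ext (by simp only [Fin.val_last]; omega)
  unfold boxWeight
  rw [if_pos ((hmunu _ b.1.2).trans hb), hlast b hb]
  refine if_congr ⟨fun ⟨hr, hc, _⟩ => ⟨hr, hc⟩, fun ⟨hr, hc⟩ => ⟨hr, hc, ?_⟩⟩ rfl rfl
  exact hlast _ ((hnu _ _ (Nat.le_succ _) hr).trans hb)

lemma HasInnerShape.prod_boxWeight {T : YBox ℓ lam → Fin (n + 1 + 1)}
    (hT : HasInnerShape ℓ n T nu) (hnu : ∀ a b : ℕ, a ≤ b → b < ℓ → nu b ≤ nu a)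
    (hmunu : ∀ r < ℓ, mu r ≤ nu r) (h : ∀ r < ℓ, nu r ≤ lam r) (x t : ℕ → R) :
    ∏ b, boxWeight ℓ (n + 1) lam mu x t T b =
      (∏ i : Fin ℓ, ∏ c ∈ Finset.Ico (nu i) (lam i),
        if (i : ℕ) + 1 < ℓ ∧ c < lam (i + 1) then t (i + 1) else x (n + 1)) *
        ∏ b, boxWeight ℓ n nu mu x t (_root_.restrictFilling n h T) b := by
  rw [Fintype.prod_sigma, Fintype.prod_sigma, ← Finset.prod_mul_distrib]
  refine Finset.prod_congr rfl fun r _ => ?_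
  let W : ℕ → R := fun c =>
    if hc : c < lam r then boxWeight ℓ (n + 1) lam mu x t T ⟨r, ⟨c, hc⟩⟩ else 1
  have hW (c : ℕ) (hc : c < lam r) :
      W c = boxWeight ℓ (n + 1) lam mu x t T ⟨r, ⟨c, hc⟩⟩ := dif_pos hc
  have h1 : ∏ c : Fin (lam r), boxWeight ℓ (n + 1) lam mu x t T ⟨r, c⟩ =
      ∏ c ∈ Finset.range (lam r), W c := by
    rw [← Fin.prod_univ_eq_prod_range]
    exact Finset.prod_congr rfl fun c _ => (hW c c.2).symm
  have h2 : ∏ c : Fin (nu r), boxWeight ℓ n nu mu x t (_root_.restrictFilling n h T) ⟨r, c⟩ =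
      ∏ c ∈ Finset.range (nu r), W c := by
    rw [← Fin.prod_univ_eq_prod_range]
    refine Finset.prod_congr rfl fun c _ => ?_
    rw [hW c (c.2.trans_le (h r r.2)), ← hT.boxWeight_incl h]
    rfl
  rw [h1, h2, ← Finset.prod_range_mul_prod_Ico _ (h r r.2), mul_comm]
  congr 1
  refine Finset.prod_congr rfl fun c hc => ?_
  rw [Finset.mem_Ico] at hc
  rw [hW c hc.2, hT.boxWeight_of_le hnu hmunu _ _ _ hc.1]

lemma sum_prod_boxWeight_hasInnerShape (hnu : ∀ a b : ℕ, a ≤ b → b < ℓ → nu b ≤ nu a)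
    (hmunu : ∀ r < ℓ, mu r ≤ nu r) (h : ∀ r < ℓ, nu r ≤ lam r) (x t : ℕ → R) :
    ∑ T ∈ Finset.univ.filter
        (fun T => IsSkewRPP ℓ (n + 1) lam mu T ∧ HasInnerShape ℓ n T nu),
        ∏ b, boxWeight ℓ (n + 1) lam mu x t T b =
      (∏ i : Fin ℓ, ∏ c ∈ Finset.Ico (nu i) (lam i),
        if (i : ℕ) + 1 < ℓ ∧ c < lam (i + 1) then t (i + 1) else x (n + 1)) *
        dualGroth ℓ n nu mu x t := by
  rw [dualGroth, Finset.mul_sum]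
  refine Finset.sum_nbij' (restrictFilling n h) (extendFilling n lam) ?_ ?_ ?_ ?_ ?_
  · intro T hT
    rw [Finset.mem_filter] at hT ⊢
    exact ⟨Finset.mem_univ _, hT.2.1.restrictFilling hT.2.2 h⟩
  · intro T hT
    rw [Finset.mem_filter] at hT ⊢
    exact ⟨Finset.mem_univ _, hT.2.extendFilling hnu hmunu, hasInnerShape_extendFilling T⟩
  · intro T hT
    exact (Finset.mem_filter.1 hT).2.2.extendFilling_restrictFilling h
  · intro T _
    exact restrictFilling_extendFilling h T
  · intro T hT
    exact (Finset.mem_filter.1 hT).2.2.prod_boxWeight hnu hmunu h x t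

/-- The number of boxes in each row of `T` with entry at most `n`. -/
def innerShape (T : YBox ℓ lam → Fin (n + 1 + 1)) (r : Fin ℓ) : ℕ :=
  (Finset.univ.filter fun c : Fin (lam r) => (T ⟨r, c⟩ : ℕ) ≤ n).card

lemma innerShape_le (T : YBox ℓ lam → Fin (n + 1 + 1)) (r : Fin ℓ) : innerShape T r ≤ lam r :=
  (Finset.card_filter_le _ _).trans (by simp)

lemma extendFin_val (p : Fin ℓ → ℕ) (r : Fin ℓ) : extendFin ℓ p r = p r :=
  dif_pos r.2

lemma Fin.mem_iff_lt_card_of_isLowerSet {m : ℕ} (s : Finset (Fin m))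
    (hs : ∀ c c', c ≤ c' → c' ∈ s → c ∈ s) (c : Fin m) : c ∈ s ↔ (c : ℕ) < s.card := by
  constructor
  · intro hc
    have := Finset.card_le_card (show Finset.Iic c ⊆ s from
      fun d hd => hs d c (Finset.mem_Iic.1 hd) hc)
    rw [Fin.card_Iic] at this
    omega
  · intro hc
    by_contra hcon
    have := Finset.card_le_card (show s ⊆ Finset.Iio c from
      fun d hd => Finset.mem_Iio.2 (not_le.1 fun hcd => hcon (hs c d hcd hd)))
    rw [Fin.card_Iio] at this
    omega

lemma IsSkewRPP.hasInnerShape {T : YBox ℓ lam → Fin (n + 1 + 1)}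
    (hR : IsSkewRPP ℓ (n + 1) lam mu T) :
    HasInnerShape ℓ n T (extendFin ℓ (innerShape T)) := by
  rintro ⟨r, c⟩
  rw [extendFin_val, innerShape, ← Fin.mem_iff_lt_card_of_isLowerSet]
  · simp
  · intro c c' hcc' hc'
    simp only [Finset.mem_filter, Finset.mem_univ, true_and] at hc' ⊢
    rcases lt_or_ge (c : ℕ) (mu r) with h | h
    · rw [(hR.1 ⟨r, c⟩).2 h]
      exact Nat.zero_le _
    · exact (Fin.le_def.1 (hR.2.1 r c c' h hcc')).trans hc'

lemma HasInnerShape.innerShape_eq {T : YBox ℓ lam → Fin (n + 1 + 1)} {p : Fin ℓ → ℕ}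
    (hT : HasInnerShape ℓ n T (extendFin ℓ p)) (hp : ∀ r : Fin ℓ, p r ≤ lam r) :
    innerShape T = p := by
  ext r
  have h (c : Fin (lam r)) : (T ⟨r, c⟩ : ℕ) ≤ n ↔ (c : ℕ) < p r := by
    rw [hT, extendFin_val]
  simp only [innerShape, h]
  rw [Fin.card_filter_val_lt]
  exact min_eq_right (hp r)

lemma IsSkewRPP.le_innerShape {T : YBox ℓ lam → Fin (n + 1 + 1)}
    (hR : IsSkewRPP ℓ (n + 1) lam mu T) (hsub : ∀ r : ℕ, r < ℓ → mu r ≤ lam r) (r : Fin ℓ) :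
    mu r ≤ innerShape T r := by
  by_contra! hlt
  have h := hR.hasInnerShape ⟨r, ⟨innerShape T r, hlt.trans_le (hsub r r.2)⟩⟩
  rw [(hR.1 _).2 hlt, extendFin_val] at h
  simp at h

lemma IsSkewRPP.antitone_innerShape {T : YBox ℓ lam → Fin (n + 1 + 1)}
    (hR : IsSkewRPP ℓ (n + 1) lam mu T) (hlam : ∀ a b : ℕ, a ≤ b → b < ℓ → lam b ≤ lam a)
    (hmu : ∀ a b : ℕ, a ≤ b → b < ℓ → mu b ≤ mu a)
    (hsub : ∀ r : ℕ, r < ℓ → mu r ≤ lam r) :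
    Antitone (innerShape T) := by
  intro r r' hrr'
  by_contra! hlt
  have hc' : innerShape T r < lam r' := hlt.trans_le (innerShape_le T r')
  have hc : innerShape T r < lam r := hc'.trans_le (hlam r r' hrr' r'.2)
  have h := hR.hasInnerShape ⟨r, ⟨innerShape T r, hc⟩⟩
  have h' := hR.hasInnerShape ⟨r', ⟨innerShape T r, hc'⟩⟩
  rw [extendFin_val] at h h'
  have hmur := hR.le_innerShape hsub r
  have := Fin.le_def.1 (hR.2.2 r r' ⟨innerShape T r, hc⟩ ⟨innerShape T r, hc'⟩ hrr' rfl hmur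
    ((hmu r r' hrr' r'.2).trans hmur))
  simp only [hlt, lt_irrefl, iff_true, iff_false] at h h'
  omega

lemma dualGroth_succ (hlam : ∀ a b : ℕ, a ≤ b → b < ℓ → lam b ≤ lam a)
    (hmu : ∀ a b : ℕ, a ≤ b → b < ℓ → mu b ≤ mu a)
    (hsub : ∀ r : ℕ, r < ℓ → mu r ≤ lam r) (x t : ℕ → R) :
    dualGroth ℓ (n + 1) lam mu x t =
      ∑ ν ∈ ((Fintype.piFinset fun i : Fin ℓ => Finset.range (lam i + 1)).filter
          Antitone).filter (fun ν => ∀ i : Fin ℓ, mu i ≤ ν i),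
        (∏ i : Fin ℓ, ∏ c ∈ Finset.Ico (ν i) (lam i),
          if (i : ℕ) + 1 < ℓ ∧ c < lam (i + 1) then t (i + 1) else x (n + 1)) *
          dualGroth ℓ n (extendFin ℓ ν) mu x t := by
  rw [dualGroth, ← Finset.sum_fiberwise_of_maps_to (g := innerShape)]
  · refine Finset.sum_congr rfl fun ν hν => ?_
    simp only [Finset.mem_filter, Fintype.mem_piFinset, Finset.mem_range, Nat.lt_succ_iff] at hν
    have hext {r : ℕ} (hr : r < ℓ) : extendFin ℓ ν r = ν ⟨r, hr⟩ := dif_pos hr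
    rw [Finset.filter_filter]
    have h := sum_prod_boxWeight_hasInnerShape (n := n) (lam := lam) (mu := mu)
      (nu := extendFin ℓ ν)
      (fun a b hab hb => by
        rw [hext hb, hext (hab.trans_lt hb)]
        exact hν.1.2 (Fin.le_def.2 hab))
      (fun r hr => by rw [hext hr]; exact hν.2 ⟨r, hr⟩) (fun r hr => by rw [hext hr]; exact hν.1.1 _) x t
    simp only [extendFin_val] at h
    rw [← h]
    refine Finset.sum_congr (Finset.filter_congr fun T _ => and_congr_right fun hR => ?_)
      fun _ _ => rfl
    exact ⟨fun h => h ▸ hR.hasInnerShape, fun h => h.innerShape_eq hν.1.1⟩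
  · intro T hT
    have hR := (Finset.mem_filter.1 hT).2
    simp only [Finset.mem_filter, Fintype.mem_piFinset, Finset.mem_range, Nat.lt_succ_iff]
    exact ⟨⟨innerShape_le T, hR.antitone_innerShape hlam hmu hsub⟩, hR.le_innerShape hsub⟩

end Branching

lemma dualGroth_eq_jacobiTrudiDet (ℓ n : ℕ) (lam mu : ℕ → ℕ)
    (hlam : ∀ a b : ℕ, a ≤ b → b < ℓ → lam b ≤ lam a)
    (hmu : ∀ a b : ℕ, a ≤ b → b < ℓ → mu b ≤ mu a)
    (hsub : ∀ r : ℕ, r < ℓ → mu r ≤ lam r) (x t : ℕ → R) :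
    dualGroth ℓ n lam mu x t =
      jacobiTrudiDet ℓ n mu x t (fun i => lam i + (ℓ - 1 - i)) := by
  induction n generalizing lam with
  | zero => rw [dualGroth_zero ℓ lam mu x t hsub, jacobiTrudiDet_zero ℓ lam mu x t hlam hmu hsub]
  | succ n ih =>
    rw [dualGroth_succ hlam hmu hsub,
      jacobiTrudiDet_succ ℓ n mu x t (fun i => lam i + (ℓ - 1 - i)) fun i hi => by
        have := hlam i (i + 1) (Nat.le_succ i) hi
        omega,
      sum_strictAnti_eq_sum_antitone, Finset.sum_filter]
    refine Finset.sum_congr rfl fun ν hν => ?_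
    simp only [Finset.mem_filter, Fintype.mem_piFinset, Finset.mem_range, Nat.lt_succ_iff] at hν
    split_ifs with h
    · have hext {r : ℕ} (hr : r < ℓ) : extendFin ℓ ν r = ν ⟨r, hr⟩ := dif_pos hr
      rw [ih (extendFin ℓ ν)
        (fun a b hab hb => by
          rw [hext hb, hext (hab.trans_lt hb)]
          exact hν.2 (Fin.le_def.2 hab))
        (fun r hr => by rw [hext hr]; exact h ⟨r, hr⟩)]
      simp only [extendFin_val]
      congr 1
      refine Finset.prod_congr rfl fun i _ => ?_
      rw [← Finset.prod_Ico_add']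
      refine Finset.prod_congr rfl fun c _ => if_congr (and_congr_right fun hi => ?_) rfl rfl
      omega
    · push Not at h
      obtain ⟨i, hi⟩ := h
      rw [jacobiTrudiDet_eq_zero ℓ n mu x t ν hmu hν.2 i hi, mul_zero]

/-- **Jacobi–Trudi formula for skew refined dual Grothendieck polynomials**
(Grinberg's conjecture):
`g_{λ/μ}(x;t) = det[ Σ_{m≥0} α_m^{ij}(t) h_{λ_i-μ_j-i+j-m}(x) ]_{i,j=1}^{ℓ}`
with `α_m^{ij}(t) = h_m(t_j,…,t_{i-1})` for `i ≥ j` and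
`α_m^{ij}(t) = e_m(-t_i,…,-t_{j-1})` for `i < j`; each inner sum (taken here
as a `finsum` over `m : ℕ`) has finitely many nonzero terms. -/
theorem skew_refined_dual_grothendieck_jacobi_trudi
    {R : Type*} [CommRing R] (ℓ n : ℕ) (lam mu : ℕ → ℕ)
    (hlam : ∀ a b : ℕ, a ≤ b → b < ℓ → lam b ≤ lam a)
    (hmu : ∀ a b : ℕ, a ≤ b → b < ℓ → mu b ≤ mu a)
    (hsub : ∀ r : ℕ, r < ℓ → mu r ≤ lam r)
    (x t : ℕ → R) :
    dualGroth ℓ n lam mu x t =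
      Matrix.det (Matrix.of fun i j : Fin ℓ =>
        ∑ᶠ m : ℕ,
          (if (j : ℕ) ≤ (i : ℕ) then
              hL m ((List.range (i.1 - j.1)).map fun a => t (j.1 + 1 + a))
            else
              eL m ((List.range (j.1 - i.1)).map fun a => -t (i.1 + 1 + a))) *
            hInt ((lam i.1 : ℤ) - (mu j.1 : ℤ) - (i.1 : ℤ) + (j.1 : ℤ) - (m : ℤ))
              ((List.range n).map fun a => x (a + 1))) := by
  rw [dualGroth_eq_jacobiTrudiDet ℓ n lam mu hlam hmu hsub, jacobiTrudiDet]
  congr 2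
  ext i j
  exact coeff_jacobiTrudi_eq_finsum ℓ n mu x t (lam i) i j

end
end

section
/- Let λ be a partition with at most n parts, x = (x_1,…,x_n), t = (t_1,…,t_{n−1}). Then the refined Grothendieck polynomial has the Schur expansion G_λ(x;t) = Σ_{μ ⊇ λ, ℓ(μ) ≤ n} E_λ^μ(−t) · s_μ(x_1,…,x_n), where E_λ^μ(t) := Σ_T ∏_{(i,j)} t_{i − T_{ij}}, the sum over all increasing elegant tableaux T of shape μ/λ — that is, fillings of the skew diagram μ/λ with positive integers strictly increasing along rows and strictly increasing down columns such that every entry in row i is at most i−1 — with the product over all boxes of T (T_{ij} the entry in row i, column j), and E_λ^μ(−t) is obtained from E_λ^μ(t) by substituting t_k ↦ −t_k for all k. -/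
open scoped Classical

noncomputable section

variable {R : Type*} [CommRing R]

/-- A semistandard set-valued tableau of shape `lam` with entries in `{1,…,n}`
(a value `v : Fin n` encodes the letter `v+1`): every box carries a nonempty
finite set, for horizontally adjacent boxes `max A ≤ min B`, and for vertically
adjacent boxes `max A < min C`. -/
def IsSVT (ℓ n : ℕ) (lam : ℕ → ℕ) (T : YBox ℓ lam → Finset (Fin n)) : Prop :=
  (∀ b : YBox ℓ lam, (T b).Nonempty) ∧
  (∀ (r : Fin ℓ) (c c' : Fin (lam r.1)), (c : ℕ) < (c' : ℕ) →
    ∀ a ∈ T ⟨r, c⟩, ∀ a' ∈ T ⟨r, c'⟩, a ≤ a') ∧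
  (∀ (r r' : Fin ℓ) (c : Fin (lam r.1)) (c' : Fin (lam r'.1)),
    (r : ℕ) < (r' : ℕ) → (c : ℕ) = (c' : ℕ) →
    ∀ a ∈ T ⟨r, c⟩, ∀ a' ∈ T ⟨r', c'⟩, a < a')

/-- The refined Grothendieck polynomial
`G_λ(x;t) = Σ_T (-1)^{|e(T)|} t^{e(T)} x^T`, summed over semistandard
set-valued tableaux of shape `lam` with entries in `{1,…,n}`, where the excess
`e_i(T)` of row `i` is the number of extra entries in row `i`. -/
def grothendieck (ℓ n : ℕ) (lam : ℕ → ℕ) (x t : ℕ → R) : R :=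
  ∑ T ∈ Finset.univ.filter (IsSVT ℓ n lam),
    (-1 : R) ^ (∑ b : YBox ℓ lam, ((T b).card - 1)) *
      (∏ b : YBox ℓ lam, t (b.1.1 + 1) ^ ((T b).card - 1)) *
      ∏ b : YBox ℓ lam, ∏ v ∈ T b, x (v.1 + 1)

/-- The increasing-elegant-tableaux weight
`E_λ^μ(t) = Σ_T ∏_{(i,j)} t_{i - T_{ij}}`, summed over all fillings of the
skew shape `mu/lam` (with at most `N` rows) by positive integers, strictly
increasing along rows and strictly increasing down columns, every entry in
row `i` being at most `i-1` (1-indexed).  Fillings are encoded by values in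
`Fin N`, the value `0` marking the boxes of `lam`. -/
def elegantWeight (N : ℕ) (lam mu : ℕ → ℕ) (tt : ℕ → R) : R :=
  ∑ T ∈ Finset.univ.filter (fun T : YBox N mu → Fin N =>
      (∀ b : YBox N mu, ((T b : ℕ) = 0 ↔ (b.2 : ℕ) < lam b.1.1)) ∧
      (∀ b : YBox N mu, lam b.1.1 ≤ (b.2 : ℕ) → (T b : ℕ) ≤ (b.1 : ℕ)) ∧
      (∀ (r : Fin N) (c c' : Fin (mu r.1)), lam r.1 ≤ (c : ℕ) → (c : ℕ) < (c' : ℕ) →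
        T ⟨r, c⟩ < T ⟨r, c'⟩) ∧
      (∀ (r r' : Fin N) (c : Fin (mu r.1)) (c' : Fin (mu r'.1)),
        (r : ℕ) < (r' : ℕ) → (c : ℕ) = (c' : ℕ) → lam r.1 ≤ (c : ℕ) →
        lam r'.1 ≤ (c' : ℕ) → T ⟨r, c⟩ < T ⟨r', c'⟩)),
    ∏ b : YBox N mu,
      if lam b.1.1 ≤ (b.2 : ℕ) then tt ((b.1 : ℕ) + 1 - (T b : ℕ)) else 1


/-- The alternant `det (x_j ^ (lam_i + n - 1 - i) ∏_{k < min i m} (1 - t_k x_j))`, in which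
only the first `m` parameters `t` are active. -/
def refinedAlternant (n m : ℕ) (lam : ℕ → ℕ) (x t : ℕ → R) : R :=
  Matrix.det (Matrix.of fun i j : Fin n =>
    x (j + 1) ^ (lam i + (n - 1 - i)) *
      ∏ k ∈ Finset.range (min i m), (1 - t (k + 1) * x (j + 1)))

theorem refinedAlternant_congr {n m : ℕ} {lam lam' : ℕ → ℕ} (h : ∀ i < n, lam i = lam' i)
    (x t : ℕ → R) : refinedAlternant n m lam x t = refinedAlternant n m lam' x t := by
  unfold refinedAlternant
  congr 1
  ext i j
  simp [h i i.2]

theorem refinedAlternant_zero_right (n m : ℕ) (lam : ℕ → ℕ) (x : ℕ → R) (t : ℕ → R) :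
    refinedAlternant n m lam x 0 = refinedAlternant n 0 lam x t := by
  simp [refinedAlternant]

/-- The parts of `lam` after adding one box to each row in `A`. -/
def addBoxes {n : ℕ} (lam : ℕ → ℕ) (A : Finset (Fin n)) (r : ℕ) : ℕ :=
  lam r + if ∃ h : r < n, (⟨r, h⟩ : Fin n) ∈ A then 1 else 0

theorem addBoxes_val {n : ℕ} (lam : ℕ → ℕ) (A : Finset (Fin n)) (r : Fin n) :
    addBoxes lam A r = lam r + if r ∈ A then 1 else 0 := by
  simp [addBoxes]

theorem refinedAlternant_succ (n m : ℕ) (lam : ℕ → ℕ) (x t : ℕ → R) :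
    refinedAlternant n (m + 1) lam x t =
      ∑ A : Finset (Fin n), (∏ i ∈ A, if m + 1 ≤ (i : ℕ) then -t (m + 1) else 0) *
        refinedAlternant n m (addBoxes lam A) x t := by
  set u : Fin n → Fin n → R := fun i j => x (j + 1) ^ (lam i + (n - 1 - i)) *
      ∏ k ∈ Finset.range (min i m), (1 - t (k + 1) * x (j + 1)) with hu
  set c : Fin n → R := fun i => if m + 1 ≤ (i : ℕ) then -t (m + 1) else 0 with hc
  set v : Fin n → Fin n → R := fun i j => c i * (x (j + 1) * u i j) with hv
  have h1 : refinedAlternant n (m + 1) lam x t = Matrix.detRowAlternating (v + u) := by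
    unfold refinedAlternant
    change Matrix.det _ = Matrix.det _
    congr 1
    ext i j
    simp only [Matrix.of_apply, Pi.add_apply, hv, hu, hc]
    split_ifs with h
    · rw [min_eq_right h, min_eq_right (by omega : m ≤ (i : ℕ)), Finset.prod_range_succ]
      ring
    · rw [min_eq_left (by omega), min_eq_left (by omega)]
      ring
  rw [h1]
  erw [MultilinearMap.map_add_univ]
  refine Finset.sum_congr rfl fun A _ => ?_
  have h2 : A.piecewise v u = fun i => (if i ∈ A then c i else 1) •
      (fun j : Fin n => x (j + 1) ^ (addBoxes lam A i + (n - 1 - i)) *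
        ∏ k ∈ Finset.range (min i m), (1 - t (k + 1) * x (j + 1))) := by
    ext i j
    by_cases h : i ∈ A
    · simp [h, hv, hu, addBoxes_val]
      ring
    · simp [h, hu, addBoxes_val]
  rw [h2]
  erw [MultilinearMap.map_smul_univ]
  rw [Finset.prod_ite_mem, Finset.univ_inter]
  rfl

theorem refinedAlternant_eq_zero {n m : ℕ} {lam : ℕ → ℕ} {i : ℕ} (hi : i + 1 < n) (hm : m ≤ i)
    (h : lam (i + 1) = lam i + 1) (x t : ℕ → R) : refinedAlternant n m lam x t = 0 := by
  refine Matrix.det_zero_of_row_eq (i := ⟨i, by omega⟩) (j := ⟨i + 1, hi⟩) (by simp) ?_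
  ext j
  simp only [Matrix.of_apply, h]
  rw [min_eq_right hm, min_eq_right (by omega),
    show lam i + (n - 1 - i) = lam i + 1 + (n - 1 - (i + 1)) by omega]

theorem refinedAlternant_branching_entry (a b : ℕ) (hab : b ≤ a) (s y z : R) :
    (1 - s * y) * z ^ (a + 1) - y ^ (a - b + 1) * (z ^ b * (1 - s * z)) =
      (z - y) * ∑ k ∈ Finset.Icc b a,
        (y ^ (a - k) * if b < k then 1 - s * y else 1) * z ^ k := by
  obtain ⟨d, rfl⟩ := Nat.exists_eq_add_of_le hab
  induction d with
  | zero => simp; ring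
  | succ d ih =>
    have h1 : ∑ k ∈ Finset.Icc b (b + (d + 1)),
        (y ^ (b + (d + 1) - k) * if b < k then 1 - s * y else 1) * z ^ k =
        y * (∑ k ∈ Finset.Icc b (b + d),
        (y ^ (b + d - k) * if b < k then 1 - s * y else 1) * z ^ k) +
          (1 - s * y) * z ^ (b + d + 1) := by
      rw [← add_assoc, Finset.sum_Icc_succ_top (by omega), Finset.mul_sum]
      congr 1
      · refine Finset.sum_congr rfl fun k hk => ?_
        rw [Finset.mem_Icc] at hk
        rw [show b + d + 1 - k = b + d - k + 1 by omega]
        ring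
      · simp [show b < b + d + 1 by omega]
    rw [h1, mul_add, mul_left_comm (z - y) y, ← ih (by omega)]
    simp only [add_tsub_cancel_left]
    ring

theorem refinedAlternant_branching [IsDomain R] (n : ℕ) (lam : ℕ → ℕ)
    (hlam : ∀ i < n, lam (i + 1) ≤ lam i) (x t : ℕ → R)
    (ht : ∀ k, 1 - t (k + 1) * x (n + 1) ≠ 0) :
    refinedAlternant (n + 1) (n + 1) lam x t =
      x (n + 1) ^ lam n * (∏ j : Fin n, (x (j + 1) - x (n + 1))) *
        ∑ p ∈ Fintype.piFinset fun i : Fin n => Finset.Icc (lam (i + 1)) (lam i),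
          (∏ i : Fin n, (x (n + 1) ^ (lam i - p i) *
            if lam (i + 1) < p i then 1 - t (i + 1) * x (n + 1) else 1)) *
          refinedAlternant n n (extendFin n p) x t := by
  set y := x (n + 1) with hy
  set P : Matrix (Fin (n + 1)) (Fin (n + 1)) R := Matrix.of fun i j =>
    x (j + 1) ^ (lam i + (n - i)) *
      ∏ k ∈ Finset.range i, (1 - t (k + 1) * x (j + 1)) with hP
  have hdet : refinedAlternant (n + 1) (n + 1) lam x t = P.det := by
    unfold refinedAlternant
    congr 1
    ext i j
    simp [hP]
  set c : ℕ → R := fun i => if i < n then 1 - t (i + 1) * y else 1 with hc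
  set L : Matrix (Fin (n + 1)) (Fin (n + 1)) R := Matrix.of fun i j =>
    if j = i then c i else if (j : ℕ) = i + 1 then -y ^ (lam i - lam (i + 1) + 1) else 0 with hL
  have hLdet : L.det = ∏ i : Fin n, (1 - t (i + 1) * y) := by
    rw [Matrix.det_of_isUpperTriangular, Fin.prod_univ_castSucc]
    · simp [hL, hc]
    · intro i j hij
      have : (j : ℕ) < i := hij
      simp [hL, Fin.ext_iff, show (j : ℕ) ≠ i by omega, show (j : ℕ) ≠ i + 1 by omega]
  have hrow : ∀ (i : Fin n) (j : Fin (n + 1)), (L * P) i.castSucc j = (x (j + 1) - y) *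
      ∑ k ∈ Finset.Icc (lam (i + 1)) (lam i),
        (y ^ (lam i - k) * if lam (i + 1) < k then 1 - t (i + 1) * y else 1) *
          (x (j + 1) ^ (k + (n - 1 - i)) *
            ∏ k ∈ Finset.range i, (1 - t (k + 1) * x (j + 1))) := by
    intro i j
    have h1 : (L * P) i.castSucc j = (1 - t (i + 1) * y) * P i.castSucc j
        - y ^ (lam i - lam (i + 1) + 1) * P i.succ j := by
      rw [Matrix.mul_apply, Finset.sum_eq_add i.castSucc i.succ (by simp [Fin.ext_iff])]
      · simp [hL, hc, Fin.ext_iff]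
        ring
      · intro b _ hb
        have h1 := hb.1
        have h2 := hb.2
        simp only [ne_eq, Fin.ext_iff, Fin.val_castSucc, Fin.val_succ] at h1 h2
        simp [hL, Fin.ext_iff, h1, h2]
      · simp
      · simp
    have h2 := refinedAlternant_branching_entry (lam i) (lam (i + 1)) (hlam i i.2) (t (i + 1)) y
      (x (j + 1))
    have h3 : ∑ k ∈ Finset.Icc (lam (i + 1)) (lam i),
        (y ^ (lam i - k) * if lam (i + 1) < k then 1 - t (i + 1) * y else 1) *
          (x (j + 1) ^ (k + (n - 1 - i)) *
            ∏ k ∈ Finset.range i, (1 - t (k + 1) * x (j + 1))) =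
        (∑ k ∈ Finset.Icc (lam (i + 1)) (lam i),
        (y ^ (lam i - k) * if lam (i + 1) < k then 1 - t (i + 1) * y else 1) * x (j + 1) ^ k) *
          (x (j + 1) ^ (n - 1 - i) * ∏ k ∈ Finset.range i, (1 - t (k + 1) * x (j + 1))) := by
      rw [Finset.sum_mul]
      refine Finset.sum_congr rfl fun k _ => ?_
      ring
    rw [h3, ← mul_assoc, ← h2, h1]
    simp only [hP, Matrix.of_apply, Fin.val_castSucc, Fin.val_succ, Finset.prod_range_succ]
    rw [show lam i + (n - i) = lam i + 1 + (n - 1 - i) by omega,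
      show n - (i + 1) = n - 1 - (i : ℕ) by omega]
    ring
  have hlast : (L * P) (Fin.last n) (Fin.last n) =
      y ^ lam n * ∏ i : Fin n, (1 - t (i + 1) * y) := by
    rw [Matrix.mul_apply, Finset.sum_eq_single (Fin.last n)]
    · simp [hL, hc, hP, ← hy, Finset.prod_range]
    · intro b _ hb
      have : (b : ℕ) ≠ n + 1 := by omega
      simp [hL, hb, this]
    · simp
  have hcol : ∀ i : Fin n, (L * P) i.castSucc (Fin.last n) = 0 := by
    intro i
    rw [hrow]
    simp [← hy]
  have hmain : (L * P).det = y ^ lam n * (∏ i : Fin n, (1 - t (i + 1) * y)) *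
      ((∏ j : Fin n, (x (j + 1) - y)) *
        ∑ p ∈ Fintype.piFinset fun i : Fin n => Finset.Icc (lam (i + 1)) (lam i),
          (∏ i : Fin n, (y ^ (lam i - p i) *
            if lam (i + 1) < p i then 1 - t (i + 1) * y else 1)) *
          refinedAlternant n n (extendFin n p) x t) := by
    rw [Matrix.det_succ_column _ (Fin.last n), Fin.sum_univ_castSucc,
      Finset.sum_eq_zero (by intro i _; simp [hcol]), zero_add, hlast]
    have h1 : ((-1 : R) ^ ((Fin.last n : ℕ) + (Fin.last n : ℕ))) = 1 :=
      Even.neg_one_pow ⟨_, rfl⟩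
    rw [h1, one_mul]
    congr 1
    have h2 : (L * P).submatrix (Fin.last n).succAbove (Fin.last n).succAbove =
        Matrix.of fun i j : Fin n => (x (j + 1) - y) *
          (Matrix.of fun i j : Fin n => ∑ k ∈ Finset.Icc (lam (i + 1)) (lam i),
        (y ^ (lam i - k) * if lam (i + 1) < k then 1 - t (i + 1) * y else 1) *
          (x (j + 1) ^ (k + (n - 1 - i)) *
            ∏ k ∈ Finset.range i, (1 - t (k + 1) * x (j + 1)))) i j := by
      ext i j
      simp [hrow]
    rw [h2, Matrix.det_mul_row]
    congr 1
    have h3 : (Matrix.of fun i j : Fin n => ∑ k ∈ Finset.Icc (lam (i + 1)) (lam i),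
        (y ^ (lam i - k) * if lam (i + 1) < k then 1 - t (i + 1) * y else 1) *
          (x (j + 1) ^ (k + (n - 1 - i)) *
            ∏ k ∈ Finset.range i, (1 - t (k + 1) * x (j + 1)))) =
        fun i : Fin n => ∑ k ∈ Finset.Icc (lam (i + 1)) (lam i),
        (y ^ (lam i - k) * if lam (i + 1) < k then 1 - t (i + 1) * y else 1) •
          (fun j : Fin n => x (j + 1) ^ (k + (n - 1 - i)) *
            ∏ k ∈ Finset.range i, (1 - t (k + 1) * x (j + 1))) := by
      ext i j
      simp only [Matrix.of_apply, Finset.sum_apply, Pi.smul_apply, smul_eq_mul]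
    rw [h3]
    change Matrix.detRowAlternating _ = _
    erw [MultilinearMap.map_sum_finset]
    refine Finset.sum_congr rfl fun p _ => ?_
    erw [MultilinearMap.map_smul_univ]
    rw [smul_eq_mul]
    congr 1
    change Matrix.det _ = Matrix.det _
    congr 1
    ext i j
    simp [extendFin]
  rw [Matrix.det_mul, hLdet] at hmain
  rw [hdet]
  refine mul_left_cancel₀ (Finset.prod_ne_zero_iff.2 fun (i : Fin n) _ => ht i) (hmain.trans ?_)
  ring

/-- Increasing elegant fillings `T` of `mu/lam` all of whose boxes satisfy `i - T_{ij} ≤ k`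
(with `i` the 1-indexed row). -/
def IsElegant (N k : ℕ) (lam mu : ℕ → ℕ) (T : YBox N mu → Fin N) : Prop :=
  ((∀ b : YBox N mu, ((T b : ℕ) = 0 ↔ (b.2 : ℕ) < lam b.1.1)) ∧
    (∀ b : YBox N mu, lam b.1.1 ≤ (b.2 : ℕ) → (T b : ℕ) ≤ (b.1 : ℕ)) ∧
    (∀ (r : Fin N) (c c' : Fin (mu r.1)), lam r.1 ≤ (c : ℕ) → (c : ℕ) < (c' : ℕ) →
      T ⟨r, c⟩ < T ⟨r, c'⟩) ∧
    (∀ (r r' : Fin N) (c : Fin (mu r.1)) (c' : Fin (mu r'.1)),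
      (r : ℕ) < (r' : ℕ) → (c : ℕ) = (c' : ℕ) → lam r.1 ≤ (c : ℕ) →
      lam r'.1 ≤ (c' : ℕ) → T ⟨r, c⟩ < T ⟨r', c'⟩)) ∧
  ∀ b : YBox N mu, lam b.1.1 ≤ (b.2 : ℕ) → (b.1 : ℕ) + 1 ≤ (T b : ℕ) + k

/-- The weight `t_{i - T_{ij}}` of a box in an elegant filling. -/
def elegantBoxWeight {N : ℕ} (lam : ℕ → ℕ) {mu : ℕ → ℕ} (tt : ℕ → R) (T : YBox N mu → Fin N)
    (b : YBox N mu) : R :=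
  if lam b.1.1 ≤ (b.2 : ℕ) then tt ((b.1 : ℕ) + 1 - (T b : ℕ)) else 1

/-- The part of `elegantWeight` involving only the parameters `t_1, …, t_k`. -/
def boundedElegantWeight (N k : ℕ) (lam mu : ℕ → ℕ) (tt : ℕ → R) : R :=
  ∑ T ∈ Finset.univ.filter (IsElegant N k lam mu), ∏ b : YBox N mu, elegantBoxWeight lam tt T b

theorem boundedElegantWeight_self (N : ℕ) (lam mu : ℕ → ℕ) (tt : ℕ → R) :
    boundedElegantWeight N N lam mu tt = elegantWeight N lam mu tt := by
  unfold boundedElegantWeight elegantWeight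
  refine Finset.sum_congr ?_ fun _ _ => rfl
  ext T
  simp only [Finset.mem_filter, Finset.mem_univ, true_and]
  refine and_iff_left_of_imp fun _ b _ => ?_
  have := b.1.2
  omega

theorem boundedElegantWeight_zero_of_eq {N : ℕ} {lam mu : ℕ → ℕ} (tt : ℕ → R)
    (h : ∀ r < N, lam r = mu r) : boundedElegantWeight N 0 lam mu tt = 1 := by
  have hb : ∀ b : YBox N mu, (b.2 : ℕ) < lam b.1 := fun b => by
    rw [h _ b.1.2]; exact b.2.2
  have h1 : Finset.univ.filter (IsElegant N 0 lam mu) =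
      {fun b => ⟨0, b.1.pos⟩} := by
    ext T
    simp only [Finset.mem_filter, Finset.mem_univ, true_and, Finset.mem_singleton]
    constructor
    · intro hT
      ext b
      exact (hT.1.1 b).2 (hb b)
    · rintro rfl
      refine ⟨⟨fun b => by simp [hb b], fun b => by simp,
        fun r c c' hc => absurd (hb ⟨r, c⟩) (by simpa using hc),
        fun r r' c c' _ _ hc => absurd (hb ⟨r, c⟩) (by simpa using hc)⟩,
        fun b hc => absurd (hb b) (by simpa using hc)⟩
  rw [boundedElegantWeight, h1, Finset.sum_singleton]
  refine Finset.prod_eq_one fun b _ => ?_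
  simp [elegantBoxWeight, hb b]

theorem boundedElegantWeight_zero_of_lt {N : ℕ} {lam mu : ℕ → ℕ} (tt : ℕ → R)
    {r : ℕ} (hr : r < N) (h : lam r < mu r) : boundedElegantWeight N 0 lam mu tt = 0 := by
  rw [boundedElegantWeight, Finset.sum_eq_zero]
  intro T hT
  simp only [Finset.mem_filter, Finset.mem_univ, true_and] at hT
  have h1 := hT.2 ⟨⟨r, hr⟩, ⟨lam r, h⟩⟩ le_rfl
  have h2 := hT.1.2.1 ⟨⟨r, hr⟩, ⟨lam r, h⟩⟩ le_rfl
  simp only at h1 h2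
  omega

theorem elegantWeight_eq_zero {N : ℕ} {lam mu : ℕ → ℕ} (tt : ℕ → R)
    {r : ℕ} (hr : r < N) (h : lam r + N < mu r) : elegantWeight N lam mu tt = 0 := by
  rw [← boundedElegantWeight_self, boundedElegantWeight, Finset.sum_eq_zero]
  intro T hT
  simp only [Finset.mem_filter, Finset.mem_univ, true_and] at hT
  let f : Fin (N + 1) → Fin N := fun c => T ⟨⟨r, hr⟩, ⟨lam r + c, by simp only; omega⟩⟩
  have hf : StrictMono f := fun c c' hc =>
    hT.1.2.2.1 ⟨r, hr⟩ _ _ (Nat.le_add_right _ _) (Nat.add_lt_add_left hc _)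
  have := Fintype.card_le_of_injective f hf.injective
  simp at this

/-- The rows in which an elegant filling has a box with `i - T_{ij} = k + 1`. -/
def elegantTopRows {N : ℕ} (k : ℕ) (lam mu : ℕ → ℕ) (T : YBox N mu → Fin N) : Finset (Fin N) :=
  Finset.univ.filter fun r => ∃ h : lam r < mu r, (T ⟨r, ⟨lam r, h⟩⟩ : ℕ) + k = r

/-- Erase the first box of `mu/lam` in each row of `A`. -/
def eraseBoxes {N : ℕ} (lam mu : ℕ → ℕ) (A : Finset (Fin N)) (T : YBox N mu → Fin N)
    (b : YBox N mu) : Fin N :=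
  if b.1 ∈ A ∧ (b.2 : ℕ) = lam b.1 then ⟨0, b.1.pos⟩ else T b

/-- Fill the first box of `mu/lam` in each row `i` of `A` so that `i - T_{ij} = k + 1`. -/
def fillBoxes {N : ℕ} (k : ℕ) (lam mu : ℕ → ℕ) (A : Finset (Fin N)) (T : YBox N mu → Fin N)
    (b : YBox N mu) : Fin N :=
  if b.1 ∈ A ∧ (b.2 : ℕ) = lam b.1 then ⟨b.1 - k, by omega⟩ else T b

/-- The sets of rows that occur as `elegantTopRows` of some filling of `mu/lam`. -/
structure IsTopRowSet {N : ℕ} (k : ℕ) (lam mu : ℕ → ℕ) (A : Finset (Fin N)) : Prop where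
  anti : ∀ i, i + 1 < N → addBoxes lam A (i + 1) ≤ addBoxes lam A i
  le : ∀ i < N, addBoxes lam A i ≤ mu i
  lt : ∀ i ∈ A, k + 1 ≤ (i : ℕ)

theorem IsElegant.isTopRowSet {N k : ℕ} {lam mu : ℕ → ℕ} {T : YBox N mu → Fin N}
    (hlam : ∀ i, i + 1 < N → lam (i + 1) ≤ lam i) (hmu : ∀ i, i + 1 < N → mu (i + 1) ≤ mu i)
    (hle : ∀ i < N, lam i ≤ mu i)
    (hT : IsElegant N (k + 1) lam mu T) : IsTopRowSet k lam mu (elegantTopRows k lam mu T) := by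
  have hmem : ∀ r : Fin N, r ∈ elegantTopRows k lam mu T ↔
      ∃ h : lam r < mu r, (T ⟨r, ⟨lam r, h⟩⟩ : ℕ) + k = r := by simp [elegantTopRows]
  refine ⟨fun i hi => ?_, fun i hi => ?_, fun i hi => ?_⟩
  · have e1 := addBoxes_val lam (elegantTopRows k lam mu T) ⟨i + 1, hi⟩
    have e2 := addBoxes_val lam (elegantTopRows k lam mu T) ⟨i, by omega⟩
    simp only at e1 e2
    rw [e1, e2]
    have h0 := hlam i hi
    by_cases hA : (⟨i + 1, hi⟩ : Fin N) ∈ elegantTopRows k lam mu T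
    · rw [if_pos hA]
      rcases h0.lt_or_eq with h0 | h0
      · omega
      · have hB : (⟨i, by omega⟩ : Fin N) ∈ elegantTopRows k lam mu T := by
          obtain ⟨h1, h2⟩ := (hmem _).1 hA
          have h3 : lam i < mu i := by have := hmu i hi; simp only at h1; omega
          refine (hmem _).2 ⟨h3, ?_⟩
          have h4 : (T ⟨⟨i, by omega⟩, ⟨lam i, h3⟩⟩ : ℕ) < T ⟨⟨i + 1, hi⟩, ⟨lam (i + 1), h1⟩⟩ :=
            hT.1.2.2.2 ⟨i, by omega⟩ ⟨i + 1, hi⟩ ⟨lam i, h3⟩ ⟨lam (i + 1), h1⟩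
              (Nat.lt_succ_self i) h0.symm le_rfl le_rfl
          have h5 := hT.2 ⟨⟨i, by omega⟩, ⟨lam i, h3⟩⟩ le_rfl
          simp only at h2 h5 ⊢
          omega
        rw [if_pos hB, h0]
    · rw [if_neg hA]
      omega
  · rw [addBoxes_val lam _ ⟨i, hi⟩]
    split_ifs with h
    · exact ((hmem _).1 h).1
    · exact hle i hi
  · obtain ⟨h1, h2⟩ := (hmem _).1 hi
    have h3 : (T ⟨i, ⟨lam i, h1⟩⟩ : ℕ) ≠ 0 := fun h => by
      have := (hT.1.1 _).1 h
      simp at this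
    omega

theorem IsElegant.erase {N k : ℕ} {lam mu : ℕ → ℕ} {T : YBox N mu → Fin N}
    (hT : IsElegant N (k + 1) lam mu T) :
    IsElegant N k (addBoxes lam (elegantTopRows k lam mu T)) mu
      (eraseBoxes lam mu (elegantTopRows k lam mu T) T) := by
  set A := elegantTopRows k lam mu T with hA
  have hmem : ∀ r : Fin N, r ∈ A ↔
      ∃ h : lam r < mu r, (T ⟨r, ⟨lam r, h⟩⟩ : ℕ) + k = r := by simp [hA, elegantTopRows]
  have hval : ∀ b : YBox N mu, addBoxes lam A b.1 ≤ b.2 →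
      lam b.1 ≤ b.2 ∧ eraseBoxes lam mu A T b = T b := by
    intro b hb
    rw [addBoxes_val] at hb
    refine ⟨by omega, if_neg fun h => ?_⟩
    rw [if_pos h.1] at hb
    omega
  refine ⟨⟨fun b => ?_, fun b hb => ?_, fun r c c' hc hcc => ?_,
    fun r r' c c' hr hcc hc hc' => ?_⟩, fun b hb => ?_⟩
  · rw [addBoxes_val]
    have h0 := hT.1.1 b
    by_cases h : b.1 ∈ A
    · simp only [eraseBoxes, h, true_and, if_true]
      split_ifs with h'
      · simp [h']
      · rw [h0]; omega
    · simp only [eraseBoxes, h, false_and, if_false, add_zero]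
      exact h0
  · rw [(hval b hb).2]
    exact hT.1.2.1 b (hval b hb).1
  · rw [(hval ⟨r, c⟩ hc).2, (hval ⟨r, c'⟩ (hc.trans hcc.le)).2]
    exact hT.1.2.2.1 r c c' (hval ⟨r, c⟩ hc).1 hcc
  · rw [(hval ⟨r, c⟩ hc).2, (hval ⟨r', c'⟩ hc').2]
    exact hT.1.2.2.2 r r' c c' hr hcc (hval ⟨r, c⟩ hc).1 (hval ⟨r', c'⟩ hc').1
  · obtain ⟨h1, h2⟩ := hval b hb
    rw [h2]
    have h3 := hT.2 b h1
    by_contra hlt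
    have h4 : (T b : ℕ) + k = b.1 := by omega
    have h5 : lam b.1 < mu b.1 := h1.trans_lt b.2.2
    rcases h1.lt_or_eq with h6 | h6
    · have h7 : (T ⟨b.1, ⟨lam b.1, h5⟩⟩ : ℕ) < T b := hT.1.2.2.1 b.1 ⟨lam b.1, h5⟩ b.2 le_rfl h6
      have h8 := hT.2 ⟨b.1, ⟨lam b.1, h5⟩⟩ le_rfl
      simp only at h8
      omega
    · have h7 : b.1 ∈ A := by
        refine (hmem _).2 ⟨h5, ?_⟩
        have : (⟨b.1, ⟨lam b.1, h5⟩⟩ : YBox N mu) = b := by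
          rcases b with ⟨r, c⟩
          congr 1
          exact Fin.ext h6
        rw [this, h4]
      rw [addBoxes_val, if_pos h7] at hb
      omega

theorem IsElegant.fill {N k : ℕ} {lam mu : ℕ → ℕ} {A : Finset (Fin N)}
    {T : YBox N mu → Fin N} (hA : IsTopRowSet k lam mu A) (hT : IsElegant N k (addBoxes lam A) mu T) :
    IsElegant N (k + 1) lam mu (fillBoxes k lam mu A T) ∧
      elegantTopRows k lam mu (fillBoxes k lam mu A T) = A := by
  have hanti : ∀ i j, i ≤ j → j < N → addBoxes lam A j ≤ addBoxes lam A i := by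
    intro i j hij
    induction j, hij using Nat.le_induction with
    | base => intro _; exact le_rfl
    | succ j _ ih => intro hj; exact (hA.anti j hj).trans (ih (by omega))
  have hcase : ∀ b : YBox N mu, lam b.1 ≤ b.2 →
      (b.1 ∈ A ∧ (b.2 : ℕ) = lam b.1 ∧ (fillBoxes k lam mu A T b : ℕ) = b.1 - k ∧
        k + 1 ≤ (b.1 : ℕ)) ∨
      (addBoxes lam A b.1 ≤ b.2 ∧ fillBoxes k lam mu A T b = T b ∧
        (b.1 : ℕ) + 1 ≤ (T b : ℕ) + k) := by
    intro b hb
    by_cases h : b.1 ∈ A ∧ (b.2 : ℕ) = lam b.1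
    · left
      exact ⟨h.1, h.2, by simp [fillBoxes, h], hA.lt _ h.1⟩
    · right
      have h1 : addBoxes lam A b.1 ≤ b.2 := by
        rw [addBoxes_val]
        by_cases h' : b.1 ∈ A
        · have : (b.2 : ℕ) ≠ lam b.1 := fun e => h ⟨h', e⟩
          rw [if_pos h']
          omega
        · simpa [h'] using hb
      exact ⟨h1, if_neg h, hT.2 b h1⟩
  have hel : IsElegant N (k + 1) lam mu (fillBoxes k lam mu A T) := by
    refine ⟨⟨fun b => ?_, fun b hb => ?_, fun r c c' hc hcc => ?_,
      fun r r' c c' hr hcc hc hc' => ?_⟩, fun b hb => ?_⟩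
    · rcases lt_or_ge (b.2 : ℕ) (lam b.1) with hb | hb
      · have h1 : ¬ (b.1 ∈ A ∧ (b.2 : ℕ) = lam b.1) := fun h => by omega
        have h2 : (b.2 : ℕ) < addBoxes lam A b.1 := by rw [addBoxes_val]; omega
        simp only [fillBoxes, if_neg h1, hb, iff_true]
        exact (hT.1.1 b).2 h2
      · refine iff_of_false ?_ (by omega)
        rcases hcase b hb with ⟨_, _, h3, h4⟩ | ⟨h1, h2, _⟩
        · omega
        · rw [h2, hT.1.1 b]; omega
    · rcases hcase b hb with ⟨_, _, h3, h4⟩ | ⟨h1, h2, _⟩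
      · omega
      · rw [h2]; exact hT.1.2.1 b h1
    · rcases hcase ⟨r, c'⟩ (hc.trans hcc.le) with ⟨_, h, _⟩ | ⟨h1, h2, h3⟩
      · simp only at h; omega
      rw [h2]
      rcases hcase ⟨r, c⟩ hc with ⟨_, h5, h6, h7⟩ | ⟨h5, h6, h7⟩
      · rw [Fin.lt_def, h6]
        simp only at h3 h7 ⊢
        omega
      · rw [h6]
        exact hT.1.2.2.1 r c c' h5 hcc
    · rcases hcase ⟨r, c⟩ hc with ⟨h4, h5, h6, h7⟩ | ⟨h5, h6, h7⟩
      · rcases hcase ⟨r', c'⟩ hc' with ⟨g4, g5, g6, g7⟩ | ⟨g5, g6, g7⟩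
        · rw [Fin.lt_def, h6, g6]
          simp only at h7 g7 ⊢
          omega
        · rw [Fin.lt_def, h6, g6]
          simp only at h7 g7 ⊢
          omega
      · rcases hcase ⟨r', c'⟩ hc' with ⟨g4, g5, g6, g7⟩ | ⟨g5, g6, g7⟩
        · exfalso
          have e1 := hanti r r' hr.le r'.2
          rw [addBoxes_val lam A r', if_pos g4] at e1
          simp only at g5 h5
          omega
        · rw [h6, g6]
          exact hT.1.2.2.2 r r' c c' hr hcc h5 g5
    · rcases hcase b hb with ⟨_, _, h3, h4⟩ | ⟨h1, h2, h3⟩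
      · omega
      · rw [h2]; omega
  refine ⟨hel, ?_⟩
  ext r
  simp only [elegantTopRows, Finset.mem_filter, Finset.mem_univ, true_and]
  constructor
  · rintro ⟨h, h'⟩
    rcases hcase ⟨r, ⟨lam r, h⟩⟩ le_rfl with ⟨h1, _⟩ | ⟨_, h2, h3⟩
    · exact h1
    · rw [h2] at h'
      simp only at h3
      omega
  · intro hr
    have h := hA.le r r.2
    rw [addBoxes_val, if_pos hr] at h
    refine ⟨h, ?_⟩
    have := hA.lt r hr
    simp only [fillBoxes, hr, and_self, if_true]
    omega

theorem prod_elegantBoxWeight_fillBoxes {N k : ℕ} {lam mu : ℕ → ℕ} {A : Finset (Fin N)}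
    (hA : IsTopRowSet k lam mu A) (tt : ℕ → R) (T : YBox N mu → Fin N) :
    ∏ b, elegantBoxWeight lam tt (fillBoxes k lam mu A T) b =
      tt (k + 1) ^ A.card * ∏ b, elegantBoxWeight (addBoxes lam A) tt T b := by
  have h1 : ∀ b : YBox N mu, elegantBoxWeight lam tt (fillBoxes k lam mu A T) b =
      (if (b.2 : ℕ) = lam b.1 then if b.1 ∈ A then tt (k + 1) else 1 else 1) *
        elegantBoxWeight (addBoxes lam A) tt T b := by
    intro b
    simp only [elegantBoxWeight, fillBoxes, addBoxes_val]
    by_cases h : b.1 ∈ A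
    · by_cases h' : (b.2 : ℕ) = lam b.1
      · have := hA.lt _ h
        simp only [h, h', if_true, and_self, le_refl]
        rw [if_neg (by omega), mul_one]
        congr 1
        omega
      · by_cases h2 : lam b.1 ≤ b.2
        · simp [h, h', h2, show lam b.1 + 1 ≤ b.2 by omega]
        · simp [h, h', h2, show ¬ lam b.1 + 1 ≤ b.2 by omega]
    · simp [h]
  simp_rw [h1]
  rw [Finset.prod_mul_distrib]
  congr 1
  rw [Fintype.prod_sigma]
  have h2 : ∀ r : Fin N, (∏ c : Fin (mu r), if (c : ℕ) = lam r then
      if r ∈ A then tt (k + 1) else 1 else 1) = if r ∈ A then tt (k + 1) else 1 := by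
    intro r
    by_cases h : r ∈ A
    · have h3 := hA.le r r.2
      rw [addBoxes_val, if_pos h] at h3
      rw [Finset.prod_eq_single ⟨lam r, h3⟩]
      · simp
      · intro c _ hc
        exact if_neg fun e => hc (Fin.ext e)
      · simp
    · simp [h]
  simp_rw [h2]
  rw [Finset.prod_ite_mem, Finset.univ_inter, Finset.prod_const]

theorem boundedElegantWeight_succ {N k : ℕ} {lam mu : ℕ → ℕ}
    (hlam : ∀ i j, i ≤ j → j < N → lam j ≤ lam i) (hmu : ∀ i, i + 1 < N → mu (i + 1) ≤ mu i)
    (hle : ∀ i < N, lam i ≤ mu i) (tt : ℕ → R) :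
    boundedElegantWeight N (k + 1) lam mu tt =
      ∑ A : Finset (Fin N), if IsTopRowSet k lam mu A then
        tt (k + 1) ^ A.card * boundedElegantWeight N k (addBoxes lam A) mu tt else 0 := by
  rw [boundedElegantWeight, ← Finset.sum_fiberwise _ (elegantTopRows k lam mu)]
  refine Finset.sum_congr rfl fun A _ => ?_
  split_ifs with hA
  · rw [boundedElegantWeight, Finset.mul_sum]
    symm
    refine Finset.sum_bij' (fun T _ => fillBoxes k lam mu A T) (fun T _ => eraseBoxes lam mu A T)
      ?_ ?_ ?_ ?_ ?_
    · intro T hT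
      simp only [Finset.mem_filter, Finset.mem_univ, true_and] at hT ⊢
      exact hT.fill hA
    · intro T hT
      simp only [Finset.mem_filter, Finset.mem_univ, true_and] at hT ⊢
      obtain ⟨hT, rfl⟩ := hT
      exact hT.erase
    · intro T hT
      simp only [Finset.mem_filter, Finset.mem_univ, true_and] at hT
      ext b
      by_cases h : b.1 ∈ A ∧ (b.2 : ℕ) = lam b.1
      · simp only [eraseBoxes, if_pos h]
        refine ((hT.1.1 b).2 ?_).symm
        rw [addBoxes_val, if_pos h.1]
        omega
      · simp only [eraseBoxes, fillBoxes, if_neg h]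
    · intro T hT
      simp only [Finset.mem_filter, Finset.mem_univ, true_and] at hT
      ext b
      by_cases h : b.1 ∈ A ∧ (b.2 : ℕ) = lam b.1
      · simp only [fillBoxes, if_pos h]
        have h1 := h.1
        rw [← hT.2] at h1
        simp only [elegantTopRows, Finset.mem_filter, Finset.mem_univ, true_and] at h1
        obtain ⟨h1, h2⟩ := h1
        have : (⟨b.1, ⟨lam b.1, h1⟩⟩ : YBox N mu) = b := by
          rcases b with ⟨r, c⟩
          congr 1
          exact Fin.ext h.2.symm
        rw [this] at h2
        omega
      · simp only [eraseBoxes, fillBoxes, if_neg h]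
    · intro T _
      exact (prod_elegantBoxWeight_fillBoxes hA tt T).symm
  · refine Finset.sum_eq_zero fun T hT => ?_
    simp only [Finset.mem_filter, Finset.mem_univ, true_and] at hT
    exact absurd (hT.2 ▸ hT.1.isTopRowSet (fun i hi => hlam i (i + 1) (by omega) hi) hmu hle) hA

theorem refinedAlternant_eq_sum_boundedElegantWeight (n k B : ℕ) (lam : ℕ → ℕ)
    (hlam : ∀ i j, i ≤ j → j < n → lam j ≤ lam i) (hB : ∀ i < n, lam i + k < B) (x t : ℕ → R) :
    refinedAlternant n k lam x t =
      ∑ p ∈ Fintype.piFinset fun _ : Fin n => Finset.range B,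
        if (∀ i j : Fin n, (i : ℕ) ≤ (j : ℕ) → p j ≤ p i) ∧ (∀ r : Fin n, lam r.1 ≤ p r) then
          boundedElegantWeight n k lam (extendFin n p) (fun a => -t a) *
            refinedAlternant n 0 (extendFin n p) x t
        else 0 := by
  induction k generalizing lam with
  | zero =>
    rw [Finset.sum_eq_single fun i : Fin n => lam i]
    · rw [if_pos ⟨fun i j hij => hlam i j hij j.2, fun _ => le_rfl⟩]
      have h : ∀ r < n, lam r = extendFin n (fun i : Fin n => lam i) r := fun r hr => by
        simp [extendFin, hr]
      rw [boundedElegantWeight_zero_of_eq _ h, one_mul, refinedAlternant_congr h]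
    · intro p _ hp
      split_ifs with h
      · obtain ⟨r, hr⟩ : ∃ r : Fin n, lam r ≠ p r := by
          by_contra! h'
          exact hp (funext fun r => (h' r).symm)
        rw [boundedElegantWeight_zero_of_lt _ r.2, zero_mul]
        have := h.2 r
        simp only [extendFin, r.2, dif_pos, Fin.eta]
        omega
      · rfl
    · intro h
      refine absurd (Fintype.mem_piFinset.2 fun i => Finset.mem_range.2 ?_) h
      exact hB i i.2
  | succ k ih =>
    rw [refinedAlternant_succ]
    have key : ∀ A : Finset (Fin n),
        (∏ i ∈ A, if k + 1 ≤ (i : ℕ) then -t (k + 1) else 0) *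
          refinedAlternant n k (addBoxes lam A) x t =
        ∑ p ∈ Fintype.piFinset fun _ : Fin n => Finset.range B,
          if (∀ i j : Fin n, (i : ℕ) ≤ (j : ℕ) → p j ≤ p i) ∧ (∀ r : Fin n, lam r.1 ≤ p r) then
            (if IsTopRowSet k lam (extendFin n p) A then
              (-t (k + 1)) ^ A.card *
                boundedElegantWeight n k (addBoxes lam A) (extendFin n p) (fun a => -t a)
              else 0) * refinedAlternant n 0 (extendFin n p) x t
          else 0 := by
      intro A
      by_cases h1 : ∀ i ∈ A, k + 1 ≤ (i : ℕ)
      swap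
      · push Not at h1
        obtain ⟨i, hi, hik⟩ := h1
        rw [Finset.prod_eq_zero hi (if_neg (by omega)), zero_mul, Finset.sum_eq_zero]
        intro p _
        rw [if_neg (fun h : IsTopRowSet k lam _ A => by have := h.lt i hi; omega)]
        simp
      rw [Finset.prod_congr rfl fun i hi => if_pos (h1 i hi), Finset.prod_const]
      by_cases h2 : ∀ i, i + 1 < n → addBoxes lam A (i + 1) ≤ addBoxes lam A i
      swap
      · have h3 := h2
        push Not at h2
        obtain ⟨i, hi, hlt⟩ := h2
        have e0 := hlam i (i + 1) (by omega) hi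
        have e1 := addBoxes_val lam A ⟨i, by omega⟩
        have e2 := addBoxes_val lam A ⟨i + 1, hi⟩
        simp only at e1 e2
        have hiA : (⟨i + 1, hi⟩ : Fin n) ∈ A := by
          by_contra h
          rw [if_neg h] at e2
          omega
        rw [if_pos hiA] at e2
        have hki := h1 _ hiA
        simp only at hki
        rw [refinedAlternant_eq_zero hi (by omega) (by split_ifs at e1 <;> omega), mul_zero,
          Finset.sum_eq_zero]
        intro p _
        rw [if_neg fun h : IsTopRowSet k lam _ A => h3 h.anti]
        simp
      have hanti : ∀ i j, i ≤ j → j < n → addBoxes lam A j ≤ addBoxes lam A i := by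
        intro i j hij
        induction j, hij using Nat.le_induction with
        | base => intro _; exact le_rfl
        | succ j _ ih => intro hj; exact (h2 j hj).trans (ih (by omega))
      rw [ih (addBoxes lam A) hanti, Finset.mul_sum]
      · refine Finset.sum_congr rfl fun p _ => ?_
        by_cases hp : ∀ i j : Fin n, (i : ℕ) ≤ (j : ℕ) → p j ≤ p i
        swap
        · rw [if_neg fun h => hp h.1, if_neg fun h => hp h.1, mul_zero]
        have hext : ∀ r : Fin n, extendFin n p r = p r := fun r => by simp [extendFin]
        by_cases hl : ∀ r : Fin n, addBoxes lam A r ≤ p r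
        · rw [if_pos ⟨hp, hl⟩, if_pos ⟨hp, fun r => le_trans (Nat.le_add_right _ _) (hl r)⟩,
            if_pos ⟨h2, fun i hi => (hl ⟨i, hi⟩).trans (hext ⟨i, hi⟩).ge, h1⟩, mul_assoc]
        · rw [if_neg fun h => hl h.2, if_neg (c := IsTopRowSet k lam _ A)
            fun h => hl fun r => (h.le r r.2).trans (hext r).le]
          simp
      · intro i hi
        have := hB i hi
        rw [addBoxes_val lam A ⟨i, hi⟩]
        split_ifs <;> simp only <;> omega
    rw [Finset.sum_congr rfl fun A _ => key A, Finset.sum_comm]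
    refine Finset.sum_congr rfl fun p _ => ?_
    split_ifs with hp
    · have hext : ∀ (r : ℕ) (hr : r < n), extendFin n p r = p ⟨r, hr⟩ := fun r hr => by
        simp [extendFin, hr]
      rw [boundedElegantWeight_succ hlam _ _ _, Finset.sum_mul]
      · intro i hi
        rw [hext _ hi, hext i (by omega)]
        exact hp.1 ⟨i, by omega⟩ ⟨i + 1, hi⟩ (Nat.le_succ i)
      · intro i hi
        rw [hext _ hi]
        exact hp.2 ⟨i, hi⟩
    · simp

/-- The factor that a box in row `r` contributes to the weight of a set-valued tableau. -/
def svtBoxWeight {n : ℕ} (x t : ℕ → R) (r : ℕ) (s : Finset (Fin n)) : R :=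
  (-t (r + 1)) ^ (s.card - 1) * ∏ v ∈ s, x (v.1 + 1)

theorem grothendieck_eq_sum_prod (ℓ n : ℕ) (lam : ℕ → ℕ) (x t : ℕ → R) :
    grothendieck ℓ n lam x t =
      ∑ T ∈ Finset.univ.filter (IsSVT ℓ n lam),
        ∏ b : YBox ℓ lam, svtBoxWeight x t b.1.1 (T b) := by
  refine Finset.sum_congr rfl fun T _ => ?_
  simp only [svtBoxWeight, Finset.prod_mul_distrib]
  simp_rw [fun b : YBox ℓ lam => neg_pow (t (b.1.1 + 1)) ((T b).card - 1)]
  rw [Finset.prod_mul_distrib, Finset.prod_pow_eq_pow_sum]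

theorem schurPoly_eq_grothendieck_zero (ℓ n : ℕ) (mu : ℕ → ℕ) (x : ℕ → R) :
    schurPoly ℓ n mu x = grothendieck ℓ n mu x 0 := by
  rw [grothendieck_eq_sum_prod]
  have hone : ∀ v : Fin (n + 1), 1 ≤ (v : ℕ) →
      ∃ w : Fin n, (w : ℕ) + 1 = v ∧ (Finset.univ.filter fun u : Fin n => (u : ℕ) + 1 = v) = {w} := by
    intro v hv
    refine ⟨⟨v - 1, by omega⟩, by simp only; omega, ?_⟩
    ext u
    simp only [Finset.mem_filter, Finset.mem_univ, true_and, Finset.mem_singleton, Fin.ext_iff]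
    omega
  refine Finset.sum_of_injOn
    (fun T b => Finset.univ.filter fun u : Fin n => (u : ℕ) + 1 = T b) ?_ ?_ ?_ ?_
  · intro T hT T' hT' h
    simp only [Finset.coe_filter, Finset.mem_univ, true_and, Set.mem_ofPred_eq] at hT hT'
    ext b
    obtain ⟨w, hw, hw'⟩ := hone _ (hT.1 b)
    have h1 := congrFun h b
    simp only [hw'] at h1
    have h2 : w ∈ ({w} : Finset (Fin n)) := Finset.mem_singleton_self w
    rw [h1] at h2
    simp only [Finset.mem_filter, Finset.mem_univ, true_and] at h2
    omega
  · intro T hT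
    simp only [Finset.coe_filter, Finset.mem_univ, true_and, Set.mem_ofPred_eq] at hT ⊢
    refine ⟨fun b => ?_, fun r c c' hc a ha a' ha' => ?_, fun r r' c c' hr hc a ha a' ha' => ?_⟩
    · obtain ⟨w, hw, _⟩ := hone _ (hT.1 b)
      exact ⟨w, by simpa using hw⟩
    · simp only [Finset.mem_filter, Finset.mem_univ, true_and] at ha ha'
      have := hT.2.1 r c c' hc.le
      rw [Fin.le_def] at this ⊢
      omega
    · simp only [Finset.mem_filter, Finset.mem_univ, true_and] at ha ha'
      have := hT.2.2 r r' c c' hr hc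
      rw [Fin.lt_def] at this ⊢
      omega
  · intro S hS hS'
    simp only [Finset.mem_filter, Finset.mem_univ, true_and] at hS
    by_cases hcard : ∀ b, (S b).card = 1
    · refine absurd ?_ hS'
      choose w hw using fun b => Finset.card_eq_one.1 (hcard b)
      refine ⟨fun b => (w b).succ, ?_, ?_⟩
      · simp only [Finset.coe_filter, Finset.mem_univ, true_and, Set.mem_ofPred_eq]
        refine ⟨fun b => by simp, fun r c c' hc => ?_, fun r r' c c' hr hc => ?_⟩
        · rcases hc.lt_or_eq with hc | hc
          · exact Fin.succ_le_succ_iff.2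
              (hS.2.1 r c c' hc _ (by simp [hw]) _ (by simp [hw]))
          · rw [Fin.ext hc]
        · exact Fin.succ_lt_succ_iff.2 (hS.2.2 r r' c c' hr hc _ (by simp [hw]) _ (by simp [hw]))
      · ext b v
        simp [hw, Fin.ext_iff]
    · push Not at hcard
      obtain ⟨b, hb⟩ := hcard
      refine Finset.prod_eq_zero (Finset.mem_univ b) ?_
      have h1 := (hS.1 b).card_pos
      simp [svtBoxWeight, show (S b).card - 1 ≠ 0 by omega]
  · intro T hT
    simp only [Finset.mem_filter, Finset.mem_univ, true_and] at hT
    refine Finset.prod_congr rfl fun b _ => ?_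
    obtain ⟨w, hw, hw'⟩ := hone _ (hT.1 b)
    simp only [hw']
    simp [svtBoxWeight, hw]

section Branching

variable {n : ℕ} {lam : ℕ → ℕ}

theorem IsSVT.row_le {ℓ : ℕ} (hlam : ∀ i j, i ≤ j → j < ℓ → lam j ≤ lam i)
    {T : YBox ℓ lam → Finset (Fin n)} (hT : IsSVT ℓ n lam T) (b : YBox ℓ lam) :
    ∀ a ∈ T b, (b.1 : ℕ) ≤ a := by
  obtain ⟨⟨r, hr⟩, c⟩ := b
  induction r with
  | zero => intro a _; exact Nat.zero_le _
  | succ r ih =>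
    intro a ha
    have h1 : (c : ℕ) < lam r := c.2.trans_le (hlam r (r + 1) (by omega) hr)
    obtain ⟨a', ha'⟩ := hT.1 ⟨⟨r, by omega⟩, ⟨c, h1⟩⟩
    have h2 := ih (by omega) ⟨c, h1⟩ a' ha'
    have h3 : a' < a := hT.2.2 ⟨r, by omega⟩ ⟨r + 1, hr⟩ ⟨c, h1⟩ c (Nat.lt_succ_self r) rfl a' ha' a ha
    rw [Fin.lt_def] at h3
    simp only at h2 ⊢
    omega

/-- The row lengths of the part of a set-valued tableau containing some non-maximal letter. -/
def svtInner (T : YBox (n + 1) lam → Finset (Fin (n + 1))) (r : Fin n) : ℕ :=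
  sInf {c | ∀ h : c < lam r, T ⟨⟨r, by omega⟩, ⟨c, h⟩⟩ = {Fin.last n}}

/-- The rows of a set-valued tableau with a box containing the maximal letter among others. -/
def svtMarks (T : YBox (n + 1) lam → Finset (Fin (n + 1))) : Finset (Fin n) :=
  Finset.univ.filter fun r => ∃ c, ∃ h : c < lam r,
    T ⟨⟨r, by omega⟩, ⟨c, h⟩⟩ ≠ {Fin.last n} ∧ Fin.last n ∈ T ⟨⟨r, by omega⟩, ⟨c, h⟩⟩

/-- The row lengths and the marked rows that occur for set-valued tableaux of shape `lam`. -/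
structure IsBranching (lam : ℕ → ℕ) (p : Fin n → ℕ) (M : Finset (Fin n)) : Prop where
  mem_Icc : ∀ r : Fin n, lam (r + 1) ≤ p r ∧ p r ≤ lam r
  lt_of_mem : ∀ r ∈ M, lam (r + 1) < p r

/-- Remove the maximal letter from a set-valued tableau. -/
def svtRestrict (p : Fin n → ℕ) (hp : ∀ r, p r ≤ lam r)
    (T : YBox (n + 1) lam → Finset (Fin (n + 1))) (b : YBox n (extendFin n p)) : Finset (Fin n) :=
  Finset.univ.filter fun v => v.castSucc ∈ T ⟨⟨b.1, by omega⟩, ⟨b.2, b.2.2.trans_le (by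
    simpa [extendFin] using hp b.1)⟩⟩

/-- Add the maximal letter to the last box of each row in `M` and to the boxes outside `p`. -/
def svtExtend (lam : ℕ → ℕ) (p : Fin n → ℕ) (M : Finset (Fin n))
    (T : YBox n (extendFin n p) → Finset (Fin n)) (b : YBox (n + 1) lam) : Finset (Fin (n + 1)) :=
  if h : ∃ h : (b.1 : ℕ) < n, (b.2 : ℕ) < p ⟨b.1, h⟩ then
    (T ⟨⟨b.1, h.1⟩, ⟨b.2, by simpa [extendFin, h.1] using h.2⟩⟩).map Fin.castSuccEmb ∪
      if ⟨b.1, h.1⟩ ∈ M ∧ (b.2 : ℕ) + 1 = p ⟨b.1, h.1⟩ then {Fin.last n} else ∅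
  else {Fin.last n}

theorem ne_singleton_last_iff {s : Finset (Fin (n + 1))} (hs : s.Nonempty) :
    s ≠ {Fin.last n} ↔ ∃ v : Fin n, v.castSucc ∈ s := by
  constructor
  · intro h
    by_contra! h'
    refine h (Finset.eq_singleton_iff_nonempty_unique_mem.2 ⟨hs, fun v hv => ?_⟩)
    induction v using Fin.lastCases with
    | last => rfl
    | cast v => exact absurd hv (h' v)
  · rintro ⟨v, hv⟩ rfl
    exact (Fin.castSucc_lt_last v).ne (Finset.mem_singleton.1 hv)

theorem IsSVT.lt_svtInner_iff {T : YBox (n + 1) lam → Finset (Fin (n + 1))}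
    (hT : IsSVT (n + 1) (n + 1) lam T) (r : Fin n) (c : ℕ) :
    c < svtInner T r ↔ ∃ h : c < lam r, T ⟨⟨r, by omega⟩, ⟨c, h⟩⟩ ≠ {Fin.last n} := by
  set S : Set ℕ := {c | ∀ h : c < lam r, T ⟨⟨r, by omega⟩, ⟨c, h⟩⟩ = {Fin.last n}} with hS
  have hup : ∀ c ∈ S, ∀ c', c < c' → c' ∈ S := by
    intro c hc c' hcc h'
    have h1 := hc (hcc.trans h')
    refine Finset.eq_singleton_iff_nonempty_unique_mem.2 ⟨hT.1 _, fun v hv => ?_⟩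
    exact Fin.last_le_iff.1 (hT.2.1 ⟨r, by omega⟩ ⟨c, hcc.trans h'⟩ ⟨c', h'⟩ hcc (Fin.last n)
      (by rw [h1]; exact Finset.mem_singleton_self _) v hv)
  have hne : S.Nonempty := ⟨lam r, fun h => absurd h (lt_irrefl _)⟩
  have hnot : c < svtInner T r ↔ c ∉ S := by
    constructor
    · exact fun h => Nat.notMem_of_lt_sInf h
    · intro h
      by_contra! hle
      rcases hle.lt_or_eq with hlt | heq
      · exact h (hup _ (Nat.sInf_mem hne) c hlt)
      · exact h (heq ▸ Nat.sInf_mem hne)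
  rw [hnot]
  simp [hS]

theorem IsSVT.last_notMem {T : YBox (n + 1) lam → Finset (Fin (n + 1))}
    (hT : IsSVT (n + 1) (n + 1) lam T) (r : Fin n) {c : ℕ} (hc : c < lam r)
    (h : c + 1 < svtInner T r) : Fin.last n ∉ T ⟨⟨r, by omega⟩, ⟨c, hc⟩⟩ := by
  intro hl
  obtain ⟨h1, h2⟩ := (hT.lt_svtInner_iff r _).1 h
  obtain ⟨v, hv⟩ := (ne_singleton_last_iff (hT.1 _)).1 h2
  exact (Fin.castSucc_lt_last v).not_ge
    (hT.2.1 ⟨r, by omega⟩ ⟨c, hc⟩ ⟨c + 1, h1⟩ (Nat.lt_succ_self c) _ hl _ hv)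

theorem IsSVT.last_mem_iff {T : YBox (n + 1) lam → Finset (Fin (n + 1))}
    (hT : IsSVT (n + 1) (n + 1) lam T) (r : Fin n) {c : ℕ} (hc : c < lam r)
    (h : c < svtInner T r) : Fin.last n ∈ T ⟨⟨r, by omega⟩, ⟨c, hc⟩⟩ ↔
      r ∈ svtMarks T ∧ c + 1 = svtInner T r := by
  constructor
  · intro hl
    refine ⟨?_, ?_⟩
    · simp only [svtMarks, Finset.mem_filter, Finset.mem_univ, true_and]
      exact ⟨c, hc, ((hT.lt_svtInner_iff r c).1 h).2, hl⟩
    · by_contra hne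
      exact hT.last_notMem r hc (by omega) hl
  · rintro ⟨hr, hcr⟩
    simp only [svtMarks, Finset.mem_filter, Finset.mem_univ, true_and] at hr
    obtain ⟨c', hc', h1, h2⟩ := hr
    have h3 := (hT.lt_svtInner_iff r c').2 ⟨hc', h1⟩
    have h4 : ¬ c' + 1 < svtInner T r := fun h' => hT.last_notMem r hc' h' h2
    obtain rfl : c' = c := by omega
    exact h2

theorem IsSVT.isBranching (hlam : ∀ i j, i ≤ j → j < n + 1 → lam j ≤ lam i)
    {T : YBox (n + 1) lam → Finset (Fin (n + 1))} (hT : IsSVT (n + 1) (n + 1) lam T) :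
    IsBranching lam (svtInner T) (svtMarks T) := by
  have hbelow : ∀ (r : Fin n) (c : ℕ) (hc : c < lam (r + 1)) (hc' : c < lam r),
      Fin.last n ∉ T ⟨⟨r, by omega⟩, ⟨c, hc'⟩⟩ := by
    intro r c hc hc' hl
    obtain ⟨a, ha⟩ := hT.1 ⟨⟨r + 1, by omega⟩, ⟨c, hc⟩⟩
    exact (Fin.le_last a).not_gt (hT.2.2 ⟨r, by omega⟩ ⟨r + 1, by omega⟩ ⟨c, hc'⟩ ⟨c, hc⟩
      (Nat.lt_succ_self _) rfl _ hl _ ha)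
  have hle : ∀ r : Fin n, lam (r + 1) ≤ svtInner T r := by
    intro r
    by_contra! hlt
    have h1 := hlam r (r + 1) (by omega) (by omega)
    refine lt_irrefl (svtInner T r) ((hT.lt_svtInner_iff r _).2 ⟨hlt.trans_le h1, fun he => ?_⟩)
    refine hbelow r _ hlt (hlt.trans_le h1) ?_
    rw [he]
    exact Finset.mem_singleton_self _
  refine ⟨fun r => ⟨hle r, ?_⟩, fun r hr => ?_⟩
  · by_contra! hlt
    obtain ⟨h, _⟩ := (hT.lt_svtInner_iff r _).1 hlt
    exact lt_irrefl _ h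
  · simp only [svtMarks, Finset.mem_filter, Finset.mem_univ, true_and] at hr
    obtain ⟨c, hc, h1, h2⟩ := hr
    have h3 := (hT.lt_svtInner_iff r c).2 ⟨hc, h1⟩
    have h4 : ¬ c < lam (r + 1) := fun h => hbelow r c h hc h2
    omega

theorem IsSVT.restrict {T : YBox (n + 1) lam → Finset (Fin (n + 1))}
    (hT : IsSVT (n + 1) (n + 1) lam T) (hp : ∀ r, svtInner T r ≤ lam r) :
    IsSVT n n (extendFin n (svtInner T)) (svtRestrict (svtInner T) hp T) := by
  refine ⟨fun b => ?_, fun r c c' hc a ha a' ha' => ?_, fun r r' c c' hr hc a ha a' ha' => ?_⟩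
  · have hb : (b.2 : ℕ) < svtInner T b.1 := b.2.2.trans_eq (by simp [extendFin])
    obtain ⟨v, hv⟩ := (ne_singleton_last_iff (hT.1 _)).1 ((hT.lt_svtInner_iff _ _).1 hb).2
    exact ⟨v, by simpa [svtRestrict] using hv⟩
  · simp only [svtRestrict, Finset.mem_filter, Finset.mem_univ, true_and] at ha ha'
    exact hT.2.1 _ _ _ hc _ ha _ ha'
  · simp only [svtRestrict, Finset.mem_filter, Finset.mem_univ, true_and] at ha ha'
    exact hT.2.2 _ _ _ _ hr hc _ ha _ ha'

theorem mem_svtExtend_castSucc {p : Fin n → ℕ} {M : Finset (Fin n)}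
    {T : YBox n (extendFin n p) → Finset (Fin n)} {b : YBox (n + 1) lam} {v : Fin n} :
    v.castSucc ∈ svtExtend lam p M T b ↔ ∃ (h : (b.1 : ℕ) < n)
      (h' : (b.2 : ℕ) < extendFin n p b.1), v ∈ T ⟨⟨b.1, h⟩, ⟨b.2, h'⟩⟩ := by
  unfold svtExtend
  split_ifs with h h1
  · simp [h.1, extendFin, h.2, (Fin.castSucc_lt_last v).ne]
  · simp [h.1, extendFin, h.2]
  · simp only [Finset.mem_singleton, (Fin.castSucc_lt_last v).ne, false_iff]
    rintro ⟨h1, h2, _⟩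
    exact h ⟨h1, by simpa [extendFin, h1] using h2⟩

theorem last_mem_svtExtend {p : Fin n → ℕ} {M : Finset (Fin n)}
    {T : YBox n (extendFin n p) → Finset (Fin n)} {b : YBox (n + 1) lam} :
    Fin.last n ∈ svtExtend lam p M T b ↔ ∀ h : (b.1 : ℕ) < n,
      p ⟨b.1, h⟩ ≤ b.2 ∨ (⟨b.1, h⟩ ∈ M ∧ (b.2 : ℕ) + 1 = p ⟨b.1, h⟩) := by
  unfold svtExtend
  split_ifs with h h1
  · simp [h.1, h1]
  · simp [h.1, h1, h.2, (Fin.castSucc_lt_last _).ne]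
  · simp only [Finset.mem_singleton, true_iff]
    intro h1
    left
    by_contra! h2
    exact h ⟨h1, h2⟩

theorem IsSVT.extend {p : Fin n → ℕ} {M : Finset (Fin n)} (hpM : IsBranching lam p M)
    (hlam : ∀ i j, i ≤ j → j < n + 1 → lam j ≤ lam i)
    {T : YBox n (extendFin n p) → Finset (Fin n)} (hT : IsSVT n n (extendFin n p) T) :
    IsSVT (n + 1) (n + 1) lam (svtExtend lam p M T) ∧ svtInner (svtExtend lam p M T) = p ∧
      svtMarks (svtExtend lam p M T) = M := by
  have hext : ∀ (r : ℕ) (hr : r < n), extendFin n p r = p ⟨r, hr⟩ := fun r hr => by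
    simp [extendFin, hr]
  have hne : ∀ b : YBox (n + 1) lam, (∃ v : Fin n, v.castSucc ∈ svtExtend lam p M T b) ↔
      ∃ h : (b.1 : ℕ) < n, (b.2 : ℕ) < p ⟨b.1, h⟩ := by
    intro b
    simp only [mem_svtExtend_castSucc]
    constructor
    · rintro ⟨v, h, h', _⟩
      exact ⟨h, by rwa [hext _ h] at h'⟩
    · rintro ⟨h, h'⟩
      rw [← hext _ h] at h'
      obtain ⟨v, hv⟩ := hT.1 ⟨⟨b.1, h⟩, ⟨b.2, h'⟩⟩
      exact ⟨v, h, h', hv⟩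
  have hsvt : IsSVT (n + 1) (n + 1) lam (svtExtend lam p M T) := by
    refine ⟨fun b => ?_, fun r c c' hc a ha a' ha' => ?_, fun r r' c c' hr hc a ha a' ha' => ?_⟩
    · by_cases h : ∃ h : (b.1 : ℕ) < n, (b.2 : ℕ) < p ⟨b.1, h⟩
      · obtain ⟨v, hv⟩ := (hne b).2 h
        exact ⟨_, hv⟩
      · refine ⟨Fin.last n, last_mem_svtExtend.2 fun h1 => Or.inl ?_⟩
        by_contra! h2
        exact h ⟨h1, h2⟩
    · induction a' using Fin.lastCases with
      | last => exact Fin.le_last a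
      | cast a' =>
        obtain ⟨h1, h2, h3⟩ := mem_svtExtend_castSucc.1 ha'
        induction a using Fin.lastCases with
        | last =>
          simp only at h1 h2
          rw [hext _ h1] at h2
          have := last_mem_svtExtend.1 ha h1
          simp only at this
          omega
        | cast a =>
          obtain ⟨g1, g2, g3⟩ := mem_svtExtend_castSucc.1 ha
          exact hT.2.1 ⟨r, h1⟩ ⟨c, g2⟩ ⟨c', h2⟩ hc a g3 a' h3
    · induction a using Fin.lastCases with
      | last =>
        exfalso
        have h1 : (r : ℕ) < n := by omega
        have h2 := last_mem_svtExtend.1 ha h1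
        have h3 := (hpM.mem_Icc ⟨r, h1⟩).1
        have h4 := hlam (r + 1) r' hr r'.2
        have h5 := c'.2
        rcases h2 with h2 | ⟨h2, h6⟩
        · simp only at h2 h3
          omega
        · have h7 := hpM.lt_of_mem _ h2
          simp only at h6 h7
          omega
      | cast a =>
        induction a' using Fin.lastCases with
        | last => exact Fin.castSucc_lt_last a
        | cast a' =>
          obtain ⟨h1, h2, h3⟩ := mem_svtExtend_castSucc.1 ha'
          obtain ⟨g1, g2, g3⟩ := mem_svtExtend_castSucc.1 ha
          exact hT.2.2 ⟨r, g1⟩ ⟨r', h1⟩ ⟨c, g2⟩ ⟨c', h2⟩ hr hc a g3 a' h3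
  have hinner : svtInner (svtExtend lam p M T) = p := by
    ext r
    refine eq_of_forall_lt_iff fun c => ?_
    rw [hsvt.lt_svtInner_iff]
    constructor
    · rintro ⟨h, h'⟩
      exact ((hne _).1 ((ne_singleton_last_iff (hsvt.1 _)).1 h')).2
    · intro h
      have h1 : c < lam r := h.trans_le (hpM.mem_Icc r).2
      exact ⟨h1, (ne_singleton_last_iff (hsvt.1 _)).2 ((hne ⟨⟨r, by omega⟩, ⟨c, h1⟩⟩).2 ⟨r.2, h⟩)⟩
  refine ⟨hsvt, hinner, ?_⟩
  ext r
  simp only [svtMarks, Finset.mem_filter, Finset.mem_univ, true_and]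
  constructor
  · rintro ⟨c, hc, h1, h2⟩
    obtain ⟨h3, h4⟩ := (hne _).1 ((ne_singleton_last_iff (hsvt.1 _)).1 h1)
    rcases last_mem_svtExtend.1 h2 h3 with h5 | h5
    · simp only at h4 h5
      omega
    · exact h5.1
  · intro hr
    have h1 := hpM.lt_of_mem r hr
    have h2 := (hpM.mem_Icc r).2
    have h3 : p r - 1 < lam r := by omega
    refine ⟨p r - 1, h3, ?_, ?_⟩
    · refine (ne_singleton_last_iff (hsvt.1 _)).2 ((hne _).2 ⟨r.2, ?_⟩)
      simp only [Fin.eta]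
      omega
    · refine last_mem_svtExtend.2 fun _ => Or.inr ⟨hr, ?_⟩
      simp only [Fin.eta]
      omega

theorem svtBoxWeight_map_castSucc (x t : ℕ → R) (r : ℕ) {s : Finset (Fin n)} (hs : s.Nonempty)
    (q : Prop) [Decidable q] : svtBoxWeight x t r (s.map Fin.castSuccEmb ∪ if q then {Fin.last n} else ∅) =
      svtBoxWeight x t r s * if q then -t (r + 1) * x (n + 1) else 1 := by
  by_cases hq : q
  · have hd : Disjoint (s.map Fin.castSuccEmb) {Fin.last n} := by
      simp [(Fin.castSucc_lt_last _).ne]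
    have hc : s.card = s.card - 1 + 1 := by have := hs.card_pos; omega
    simp only [svtBoxWeight, hq, if_true]
    rw [Finset.card_union_of_disjoint hd, Finset.prod_union hd, Finset.card_map, Finset.prod_map,
      Finset.card_singleton, Finset.prod_singleton, Nat.add_sub_cancel, hc, pow_succ]
    simp
    ring
  · simp [svtBoxWeight, hq]

theorem prod_svtBoxWeight_svtExtend {p : Fin n → ℕ} {M : Finset (Fin n)}
    (hpM : IsBranching lam p M) (x t : ℕ → R) {T : YBox n (extendFin n p) → Finset (Fin n)}
    (hT : ∀ b, (T b).Nonempty) :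
    ∏ b, svtBoxWeight x t b.1.1 (svtExtend lam p M T b) =
      x (n + 1) ^ lam n * (∏ r : Fin n, x (n + 1) ^ (lam r - p r)) *
        (∏ r ∈ M, -t (r + 1) * x (n + 1)) * ∏ b, svtBoxWeight x t b.1.1 (T b) := by
  have hext : ∀ r : Fin n, extendFin n p r = p r := fun r => by simp [extendFin]
  have hlast : ∀ r, svtBoxWeight x t r {Fin.last n} = x (n + 1) := by simp [svtBoxWeight]
  rw [Fintype.prod_sigma, Fin.prod_univ_castSucc, Fintype.prod_sigma]
  have h1 : ∀ c : Fin (lam (Fin.last n)),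
      svtBoxWeight x t (Fin.last n) (svtExtend lam p M T ⟨Fin.last n, c⟩) = x (n + 1) := by
    intro c
    simp [svtExtend, hlast]
  have h2 : ∀ r : Fin n, ∏ c : Fin (lam r.castSucc),
      svtBoxWeight x t r.castSucc (svtExtend lam p M T ⟨r.castSucc, c⟩) =
      x (n + 1) ^ (lam r - p r) * (if r ∈ M then -t (r + 1) * x (n + 1) else 1) *
        ∏ c : Fin (extendFin n p r), svtBoxWeight x t r (T ⟨r, c⟩) := by
    intro r
    set F : ℕ → R := fun c => if h : c < extendFin n p r then svtBoxWeight x t r (T ⟨r, ⟨c, h⟩⟩)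
      else x (n + 1) with hF
    have h3 : ∀ c : Fin (lam r.castSucc),
        svtBoxWeight x t r.castSucc (svtExtend lam p M T ⟨r.castSucc, c⟩) =
        F c * if r ∈ M ∧ (c : ℕ) + 1 = p r then -t (r + 1) * x (n + 1) else 1 := by
      intro c
      by_cases hc : (c : ℕ) < p r
      · have := svtBoxWeight_map_castSucc x t r (hT ⟨r, ⟨c, by rwa [hext]⟩⟩)
          (r ∈ M ∧ (c : ℕ) + 1 = p r)
        simp only [hF, hext, hc, dif_pos]
        rw [← this]
        simp [svtExtend, hc]
      · simp [svtExtend, hc, hF, hext, hlast, show (c : ℕ) + 1 ≠ p r by omega]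
    rw [Finset.prod_congr rfl fun c _ => h3 c, Finset.prod_mul_distrib]
    have h4 : ∏ c : Fin (lam r.castSucc), F c =
        (∏ c : Fin (extendFin n p r), svtBoxWeight x t r (T ⟨r, c⟩)) *
          x (n + 1) ^ (lam r - p r) := by
      obtain ⟨d, hd⟩ := Nat.exists_eq_add_of_le (hpM.mem_Icc r).2
      rw [← Finset.prod_range, Fin.val_castSucc, hd, ← hext, Finset.prod_range_add,
        Finset.prod_range, Nat.add_sub_cancel_left]
      simp [hF]
    have h5 : (∏ c : Fin (lam r.castSucc),
        if r ∈ M ∧ (c : ℕ) + 1 = p r then -t (r + 1) * x (n + 1) else 1) =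
        if r ∈ M then -t (r + 1) * x (n + 1) else 1 := by
      by_cases hr : r ∈ M
      · have h6 := hpM.lt_of_mem r hr
        have h7 := (hpM.mem_Icc r).2
        have h8 : p r - 1 < lam r.castSucc := by simp only [Fin.val_castSucc]; omega
        rw [Finset.prod_eq_single ⟨p r - 1, h8⟩]
        · simp [hr, show p r - 1 + 1 = p r by omega]
        · intro c _ hc
          refine if_neg fun h => hc (Fin.ext ?_)
          simp only
          omega
        · simp
      · simp [hr]
    rw [h4, h5]
    ring
  rw [Finset.prod_congr rfl fun r _ => h2 r, Finset.prod_congr rfl fun c _ => h1 c]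
  simp only [Finset.prod_mul_distrib, Finset.prod_const, Finset.card_univ, Fintype.card_fin,
    Finset.prod_ite_mem, Finset.univ_inter, Fin.val_last]
  ring

theorem sum_svtBoxWeight_fiber (hlam : ∀ i j, i ≤ j → j < n + 1 → lam j ≤ lam i)
    {p : Fin n → ℕ} {M : Finset (Fin n)} (hpM : IsBranching lam p M) (x t : ℕ → R) :
    (∑ T ∈ Finset.univ.filter (IsSVT (n + 1) (n + 1) lam) with (svtInner T, svtMarks T) = (p, M),
      ∏ b, svtBoxWeight x t b.1.1 (T b)) =
      x (n + 1) ^ lam n * (∏ r : Fin n, x (n + 1) ^ (lam r - p r)) *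
        (∏ r ∈ M, -t (r + 1) * x (n + 1)) * grothendieck n n (extendFin n p) x t := by
  rw [grothendieck_eq_sum_prod, Finset.mul_sum]
  symm
  refine Finset.sum_bij' (fun T _ => svtExtend lam p M T)
    (fun T _ => svtRestrict p (fun r => (hpM.mem_Icc r).2) T) ?_ ?_ ?_ ?_ ?_
  · intro T hT
    simp only [Finset.mem_filter, Finset.mem_univ, true_and, Prod.mk.injEq] at hT ⊢
    exact hT.extend hpM hlam
  · intro T hT
    simp only [Finset.mem_filter, Finset.mem_univ, true_and, Prod.mk.injEq] at hT ⊢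
    obtain ⟨hT, rfl, rfl⟩ := hT
    exact hT.restrict _
  · intro T hT
    ext b v
    simp only [svtRestrict, Finset.mem_filter, Finset.mem_univ, true_and, mem_svtExtend_castSucc]
    exact ⟨fun ⟨_, _, h⟩ => h, fun h => ⟨b.1.2, b.2.2, h⟩⟩
  · intro T hT
    simp only [Finset.mem_filter, Finset.mem_univ, true_and, Prod.mk.injEq] at hT
    obtain ⟨hT, rfl, rfl⟩ := hT
    ext b v
    obtain ⟨r, c⟩ := b
    induction r using Fin.lastCases with
    | last =>
      have h1 : ∀ a ∈ T ⟨Fin.last n, c⟩, a = Fin.last n := fun a ha =>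
        Fin.last_le_iff.1 (hT.row_le hlam _ a ha)
      have h2 : T ⟨Fin.last n, c⟩ = {Fin.last n} :=
        Finset.eq_singleton_iff_nonempty_unique_mem.2 ⟨hT.1 _, h1⟩
      rw [h2]
      simp [svtExtend]
    | cast r =>
      have hext : extendFin n (svtInner T) r = svtInner T r := by simp [extendFin]
      by_cases hc : (c : ℕ) < svtInner T r
      · induction v using Fin.lastCases with
        | last =>
          rw [last_mem_svtExtend]
          refine Iff.trans ?_ (hT.last_mem_iff r c.2 hc).symm
          constructor
          · intro h
            exact (h r.2).resolve_left (not_le.2 hc)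
          · exact fun h _ => Or.inr h
        | cast v =>
          rw [mem_svtExtend_castSucc]
          simp only [svtRestrict, Finset.mem_filter, Finset.mem_univ, true_and]
          exact ⟨fun ⟨_, _, h⟩ => h, fun h => ⟨r.2, hc.trans_eq hext.symm, h⟩⟩
      · have h1 : T ⟨r.castSucc, c⟩ = {Fin.last n} := by
          by_contra h
          exact hc ((hT.lt_svtInner_iff r c).2 ⟨c.2, h⟩)
        rw [h1]
        simp [svtExtend, hc]
  · intro T hT
    simp only [Finset.mem_filter, Finset.mem_univ, true_and] at hT
    exact (prod_svtBoxWeight_svtExtend hpM x t hT.1).symm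

theorem grothendieck_branching (hlam : ∀ i j, i ≤ j → j < n + 1 → lam j ≤ lam i) (x t : ℕ → R) :
    grothendieck (n + 1) (n + 1) lam x t = x (n + 1) ^ lam n *
      ∑ p ∈ Fintype.piFinset fun i : Fin n => Finset.Icc (lam (i + 1)) (lam i),
        (∏ i : Fin n, (x (n + 1) ^ (lam i - p i) *
          if lam (i + 1) < p i then 1 - t (i + 1) * x (n + 1) else 1)) *
        grothendieck n n (extendFin n p) x t := by
  rw [grothendieck_eq_sum_prod, ← Finset.sum_fiberwise_of_maps_to
    (t := (Fintype.piFinset fun i : Fin n => Finset.Icc (lam (i + 1)) (lam i)) ×ˢ Finset.univ)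
    (g := fun T => (svtInner T, svtMarks T)), Finset.sum_product, Finset.mul_sum]
  · refine Finset.sum_congr rfl fun p hp => ?_
    simp only [Fintype.mem_piFinset, Finset.mem_Icc] at hp
    have h1 : ∏ i : Fin n, (x (n + 1) ^ (lam i - p i) *
          if lam (i + 1) < p i then 1 - t (i + 1) * x (n + 1) else 1) =
        (∏ i : Fin n, x (n + 1) ^ (lam i - p i)) * ∑ M : Finset (Fin n),
          ∏ i ∈ M, if lam (i + 1) < p i then -t (i + 1) * x (n + 1) else 0 := by
      rw [Finset.prod_mul_distrib]
      congr 1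
      rw [← Finset.powerset_univ, ← Finset.prod_one_add]
      refine Finset.prod_congr rfl fun i _ => ?_
      split_ifs <;> ring
    rw [h1, Finset.mul_sum, Finset.sum_mul, Finset.mul_sum]
    refine Finset.sum_congr rfl fun M _ => ?_
    by_cases hM : ∀ r ∈ M, lam (r + 1) < p r
    · rw [sum_svtBoxWeight_fiber hlam ⟨hp, hM⟩, Finset.prod_congr rfl fun i hi => if_pos (hM i hi)]
      ring
    · rw [Finset.sum_eq_zero]
      · push Not at hM
        obtain ⟨r, hr, hr'⟩ := hM
        rw [Finset.prod_eq_zero hr (if_neg (not_lt.2 hr'))]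
        ring
      · intro T hT
        simp only [Finset.mem_filter, Finset.mem_univ, true_and, Prod.mk.injEq] at hT
        obtain ⟨hT, rfl, rfl⟩ := hT
        exact absurd (hT.isBranching hlam).lt_of_mem hM
  · intro T hT
    simp only [Finset.mem_filter, Finset.mem_univ, true_and] at hT
    simpa using (hT.isBranching hlam).mem_Icc

end Branching

/-- The Vandermonde product of `x_1, …, x_n`. -/
def vandermondeProd (x : ℕ → R) (n : ℕ) : R :=
  ∏ m ∈ Finset.range n, ∏ j : Fin m, (x (j + 1) - x (m + 1))

theorem refinedAlternant_eq_vandermondeProd_mul [IsDomain R] (x t : ℕ → R)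
    (ht : ∀ k i, 1 - t (k + 1) * x (i + 1) ≠ 0) (n : ℕ) (lam : ℕ → ℕ)
    (hlam : ∀ i j, i ≤ j → j < n → lam j ≤ lam i) :
    refinedAlternant n n lam x t = vandermondeProd x n * grothendieck n n lam x t := by
  induction n generalizing lam with
  | zero =>
    have h : (Finset.univ.filter (IsSVT 0 0 lam)) = Finset.univ :=
      Finset.filter_true_of_mem fun T _ => ⟨fun b => b.1.elim0, fun r => r.elim0, fun r => r.elim0⟩
    rw [grothendieck_eq_sum_prod, h]
    simp [refinedAlternant, vandermondeProd]
  | succ n ih =>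
    rw [refinedAlternant_branching n lam (fun i hi => hlam i (i + 1) (by omega) (by omega)) x t
      fun k => ht k n, grothendieck_branching hlam, vandermondeProd, Finset.prod_range_succ,
      ← vandermondeProd]
    simp only [Finset.mul_sum]
    refine Finset.sum_congr rfl fun p hp => ?_
    simp only [Fintype.mem_piFinset, Finset.mem_Icc] at hp
    rw [ih]
    · ring
    · have h1 : ∀ (i : ℕ) (hi : i < n), extendFin n p i = p ⟨i, hi⟩ := fun i hi => by
        simp [extendFin, hi]
      intro i j hij hj
      rcases hij.lt_or_eq with hij | rfl
      · rw [h1 i (by omega), h1 j hj]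
        have h2 := (hp ⟨i, by omega⟩).1
        have h3 := (hp ⟨j, hj⟩).2
        have h4 := hlam (i + 1) j hij (by omega)
        simp only at h2 h3
        omega
      · exact le_rfl

/-- The Schur expansion over a finite set of partitions. -/
theorem grothendieck_eq_sum_of_isDomain [IsDomain R] (n B : ℕ) (lam : ℕ → ℕ)
    (hlam : ∀ i j, i ≤ j → j < n → lam j ≤ lam i) (hB : ∀ i < n, lam i + n < B) (x t : ℕ → R)
    (ht : ∀ k i, 1 - t (k + 1) * x (i + 1) ≠ 0) (hx : Function.Injective x) :
    grothendieck n n lam x t =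
      ∑ p ∈ Fintype.piFinset fun _ : Fin n => Finset.range B,
        if (∀ i j : Fin n, (i : ℕ) ≤ (j : ℕ) → p j ≤ p i) ∧ (∀ r : Fin n, lam r.1 ≤ p r) then
          elegantWeight n lam (extendFin n p) (fun a => -t a) * schurPoly n n (extendFin n p) x
        else 0 := by
  have hV : vandermondeProd x n ≠ 0 := by
    refine Finset.prod_ne_zero_iff.2 fun m _ => Finset.prod_ne_zero_iff.2 fun j _ => ?_
    refine sub_ne_zero.2 fun h => ?_
    have := hx h
    omega
  refine mul_left_cancel₀ hV ?_
  rw [← refinedAlternant_eq_vandermondeProd_mul x t ht n lam hlam,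
    refinedAlternant_eq_sum_boundedElegantWeight n n B lam hlam hB, Finset.mul_sum]
  refine Finset.sum_congr rfl fun p _ => ?_
  split_ifs with hp
  · rw [boundedElegantWeight_self, schurPoly_eq_grothendieck_zero,
      ← refinedAlternant_zero_right n n, refinedAlternant_eq_vandermondeProd_mul x 0 (by simp)]
    · ring
    · intro i j hij hj
      simpa [extendFin, hj, hij.trans_lt hj] using hp.1 ⟨i, by omega⟩ ⟨j, hj⟩ hij
  · simp

section Map

variable {S : Type*} [CommRing S] (f : S →+* R)

theorem map_grothendieck (ℓ n : ℕ) (lam : ℕ → ℕ) (x t : ℕ → S) :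
    f (grothendieck ℓ n lam x t) = grothendieck ℓ n lam (fun i => f (x i)) fun i => f (t i) := by
  simp [grothendieck]

theorem map_schurPoly (ℓ n : ℕ) (lam : ℕ → ℕ) (x : ℕ → S) :
    f (schurPoly ℓ n lam x) = schurPoly ℓ n lam fun i => f (x i) := by
  simp [schurPoly]

theorem map_elegantWeight (n : ℕ) (lam mu : ℕ → ℕ) (t : ℕ → S) :
    f (elegantWeight n lam mu t) = elegantWeight n lam mu fun i => f (t i) := by
  simp [elegantWeight, apply_ite f]

end Map

theorem grothendieck_eq_sum (n B : ℕ) (lam : ℕ → ℕ)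
    (hlam : ∀ i j, i ≤ j → j < n → lam j ≤ lam i) (hB : ∀ i < n, lam i + n < B) (x t : ℕ → R) :
    grothendieck n n lam x t =
      ∑ p ∈ Fintype.piFinset fun _ : Fin n => Finset.range B,
        if (∀ i j : Fin n, (i : ℕ) ≤ (j : ℕ) → p j ≤ p i) ∧ (∀ r : Fin n, lam r.1 ≤ p r) then
          elegantWeight n lam (extendFin n p) (fun a => -t a) * schurPoly n n (extendFin n p) x
        else 0 := by
  let X : ℕ → MvPolynomial (ℕ ⊕ ℕ) ℤ := fun i => MvPolynomial.X (Sum.inl i)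
  let Y : ℕ → MvPolynomial (ℕ ⊕ ℕ) ℤ := fun i => MvPolynomial.X (Sum.inr i)
  have hX : Function.Injective X := fun i j h => Sum.inl_injective (MvPolynomial.X_injective h)
  have hY : ∀ k i, 1 - Y (k + 1) * X (i + 1) ≠ 0 := by
    intro k i h
    simpa [X, Y] using congrArg (MvPolynomial.eval 0) h
  have key := congrArg (MvPolynomial.eval₂Hom (Int.castRingHom R) (Sum.elim x t))
    (grothendieck_eq_sum_of_isDomain n B lam hlam hB X Y hY hX)
  simpa only [map_grothendieck, map_sum, apply_ite (MvPolynomial.eval₂Hom _ _), map_mul, map_zero,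
    map_elegantWeight, map_schurPoly, map_neg, X, Y, MvPolynomial.coe_eval₂Hom,
    MvPolynomial.eval₂_X, Sum.elim_inl, Sum.elim_inr] using key

/-- **Schur expansion of refined Grothendieck polynomials.**
`G_λ(x;t) = Σ_{μ ⊇ λ, ℓ(μ) ≤ n} E_λ^μ(-t) s_μ(x_1,…,x_n)`, where `E_λ^μ` is
the generating function of increasing elegant tableaux of shape `μ/λ`.  The
(finitely supported) sum over `μ` is taken as a `finsum` over functions
`p : Fin n → ℕ`, the summand being nonzero only for partitions `μ ⊇ λ`. -/
theorem refined_grothendieck_schur_expansion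
    {R : Type*} [CommRing R] (n : ℕ) (lam : ℕ → ℕ)
    (hlam : ∀ a b : ℕ, a ≤ b → b < n → lam b ≤ lam a)
    (x t : ℕ → R) :
    grothendieck n n lam x t =
      ∑ᶠ p : Fin n → ℕ,
        if (∀ i j : Fin n, (i : ℕ) ≤ (j : ℕ) → p j ≤ p i) ∧
            (∀ r : Fin n, lam r.1 ≤ p r) then
          elegantWeight n lam (extendFin n p) (fun a => -t a) *
            schurPoly n n (extendFin n p) x
        else 0 := by
  obtain ⟨B, hB⟩ : ∃ B, ∀ i < n, lam i + n < B :=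
    ⟨lam 0 + n + 1, fun i hi => by have := hlam 0 i (Nat.zero_le i) hi; omega⟩
  rw [grothendieck_eq_sum n B lam hlam hB]
  refine (finsum_eq_sum_of_support_subset _ fun p hp => ?_).symm
  by_contra hpB
  simp only [Finset.mem_coe, Fintype.mem_piFinset, Finset.mem_range, not_forall, not_lt] at hpB
  obtain ⟨r, hr⟩ := hpB
  have h := hB r r.2
  have h0 : elegantWeight n lam (extendFin n p) (fun a => -t a) = 0 :=
    elegantWeight_eq_zero _ r.2 (by simp only [extendFin, r.2, dif_pos, Fin.eta]; omega)
  exact hp (by simp only [h0, zero_mul, ite_self])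

end
end
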